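/- Let (W,S) be a finite Coxeter system with longest element w₀ and let c be a Coxeter element of W. For every w ∈ W, the following are equivalent: (a) w is c-sortable and ws is c-sortable for every s ∈ S with ℓ(ws) > ℓ(w); (b) w is c-sortable and ww₀ is c⁻¹-sortable (i.e., w is also c-antisortable). -/

import Mathlib

noncomputable section

namespace CambrianPaper

open CoxeterSystem

variable {B : Type*} {W : Type*} [Group W] {M : CoxeterMatrix B}

/-- One greedy pass of the letters of `c` over `u`: returns the taken letters (in order) and
the new remainder.  A letter `q` is taken if it is a left descent of the current remainder. -/
def pass (cs : CoxeterSystem M W) (c : List B) (u : W) : List B × W :=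
  c.foldl (fun p q =>
    if cs.length (cs.simple q * p.2) < cs.length p.2 then (p.1 ++ [q], cs.simple q * p.2)
    else p) ([], u)

/-- The remainder of `w` after `n` greedy passes of `c`. -/
def remainder (cs : CoxeterSystem M W) (c : List B) (w : W) : ℕ → W
  | 0 => w
  | n + 1 => (pass cs c (remainder cs c w n)).2

/-- The `n`-th factor (`n = 0, 1, 2, …`) of the `c`-factorization of `w`:
the letters of `c` taken in the `n`-th greedy pass.  (All but finitely many factors are
empty; the nonempty ones are the `c_{(K_i)}` of the `c`-factorization of `w`.) -/
def factor (cs : CoxeterSystem M W) (c : List B) (w : W) (n : ℕ) : List B :=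
  (pass cs c (remainder cs c w n)).1

/-- The `c`-sorting word of `w` : the concatenation of the factors of the
`c`-factorization of `w` (the lexicographically first reduced subword of `c^∞` for `w`);
`cs.length w` passes always suffice. -/
def sortingWord (cs : CoxeterSystem M W) (c : List B) (w : W) : List B :=
  ((List.range (cs.length w)).map (factor cs c w)).flatten

/-- `w` is `c`-sortable : the factors of its `c`-factorization are nested. -/
def IsSortable (cs : CoxeterSystem M W) (c : List B) (w : W) : Prop :=
  ∀ n : ℕ, ∀ q ∈ factor cs c w (n + 1), q ∈ factor cs c w n

/-- `w` is a `c`-singleton : `w` is `c`-sortable and `w w₀` is `c⁻¹`-sortable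
(the reduced word `c.reverse` represents the inverse of the Coxeter element). -/
def IsCSingleton (cs : CoxeterSystem M W) (c : List B) (w₀ w : W) : Prop :=
  IsSortable cs c w ∧ IsSortable cs c.reverse (w * w₀)

/-- The right weak order on `W`. -/
def weakLE (cs : CoxeterSystem M W) (u v : W) : Prop :=
  cs.length v = cs.length u + cs.length (u⁻¹ * v)

/-- A single commutation move on words: interchange two adjacent commuting letters. -/
def CommMove (M : CoxeterMatrix B) (l l' : List B) : Prop :=
  ∃ l₁ l₂ : List B, ∃ a b : B, M a b = 2 ∧ l = l₁ ++ a :: b :: l₂ ∧ l' = l₁ ++ b :: a :: l₂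

/-- Equivalence of words up to commutations. -/
def CommEquiv (M : CoxeterMatrix B) : List B → List B → Prop :=
  Relation.ReflTransGen (CommMove M)

/-- `u ∈ W` is a prefix of the word `v` up to commutations. -/
def IsPrefixUpToComm (cs : CoxeterSystem M W) (v : List B) (u : W) : Prop :=
  ∃ v' u' : List B, CommEquiv M v v' ∧ u' <+: v' ∧ cs.wordProd u' = u

section Geometric

set_option linter.unusedSectionVars false

open Real Polynomial.Chebyshev

/-- The Cartan matrix `-2 cos (π / m(a,b))` of a Coxeter matrix. -/
def cartan (M : CoxeterMatrix B) (a b : B) : ℝ := -2 * cos (π / M a b)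

lemma cartan_self (M : CoxeterMatrix B) (a : B) : cartan M a a = 2 := by
  simp [cartan]

lemma cartan_comm (M : CoxeterMatrix B) (a b : B) : cartan M a b = cartan M b a := by
  simp [cartan, M.symmetric a b]

lemma cartan_nonpos (M : CoxeterMatrix B) {a b : B} (h : a ≠ b) : cartan M a b ≤ 0 := by
  have h1 := M.off_diagonal a b h
  have : 0 ≤ cos (π / M a b) := by
    rcases Nat.eq_zero_or_pos (M a b) with h0 | h0
    · simp [h0]
    · have h2 : (2 : ℝ) ≤ M a b := by exact_mod_cast (by omega : 2 ≤ M a b)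
      apply cos_nonneg_of_mem_Icc
      constructor
      · have : 0 ≤ π / M a b := by positivity
        linarith [pi_pos]
      · exact div_le_div_of_nonneg_left pi_pos.le (by norm_num) h2
  unfold cartan
  linarith

lemma eval_S_eq_div {θ : ℝ} (h : sin θ ≠ 0) (n : ℤ) :
    (S ℝ n).eval (2 * cos θ) = sin ((n + 1) * θ) / sin θ := by
  rw [eq_div_iff h, S_two_mul_real_cos]

lemma eval_S_nonneg (m k : ℕ) (hm : m ≠ 1) (hk : m = 0 ∨ k < m) :
    0 ≤ (S ℝ k).eval (2 * cos (π / m)) := by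
  rcases Nat.eq_zero_or_pos m with h0 | h0
  · subst h0
    simp only [CharP.cast_eq_zero, div_zero, cos_zero, mul_one]
    rw [S_eval_two]
    positivity
  · have hk : k < m := by omega
    have hm2 : (2 : ℝ) ≤ m := by exact_mod_cast (by omega : 2 ≤ m)
    have hmpos : (0 : ℝ) < m := by positivity
    have hmul : m * (π / m) = π := by field_simp
    have hpos : 0 < π / m := by positivity
    have hlt : π / m < π := by nlinarith [pi_pos]
    have hsin := sin_pos_of_pos_of_lt_pi hpos hlt
    rw [eval_S_eq_div hsin.ne']
    apply div_nonneg _ hsin.le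
    have hkm : ((k : ℝ) + 1) ≤ m := by exact_mod_cast hk
    apply sin_nonneg_of_nonneg_of_le_pi
    · push_cast; positivity
    · push_cast; nlinarith

section

variable [Fintype B]

/-- The linear functional `⟨α_s^∨, ·⟩` of the geometric representation. -/
def coroot (M : CoxeterMatrix B) (s : B) : (B → ℝ) →ₗ[ℝ] ℝ :=
  ∑ b, cartan M s b • LinearMap.proj b

lemma coroot_apply (M : CoxeterMatrix B) (s : B) (v : B → ℝ) :
    coroot M s v = ∑ b, cartan M s b * v b := by
  simp [coroot]

variable [DecidableEq B]

lemma coroot_single (M : CoxeterMatrix B) (s b : B) :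
    coroot M s (Pi.single b 1) = cartan M s b := by
  simp [coroot_apply, Pi.single_apply]

lemma coroot_single_self (M : CoxeterMatrix B) (s : B) :
    coroot M s (Pi.single s (1 : ℝ)) = 2 := by
  rw [coroot_single, cartan_self]

/-- The simple reflections of the geometric representation. -/
def geomSimple (M : CoxeterMatrix B) (s : B) : (B → ℝ) ≃ₗ[ℝ] (B → ℝ) :=
  Module.reflection (coroot_single_self M s)

lemma geomSimple_apply (M : CoxeterMatrix B) (s : B) (v : B → ℝ) :
    geomSimple M s v = v - coroot M s v • Pi.single s 1 := by
  simp [geomSimple, Module.reflection_apply]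

lemma geomSimple_geomSimple (M : CoxeterMatrix B) (s : B) (v : B → ℝ) :
    geomSimple M s (geomSimple M s v) = v :=
  Module.involutive_reflection (coroot_single_self M s) v

lemma isLiftable_geomSimple (M : CoxeterMatrix B) : M.IsLiftable (geomSimple M) := by
  intro a b
  by_cases hab : a = b
  · subst hab
    ext1 v
    simp [LinearEquiv.mul_apply, geomSimple_geomSimple]
  have h1 := M.off_diagonal a b hab
  generalize hm : M a b = m at h1
  have hab1 : coroot M a (Pi.single b 1) = -2 * cos (π / m) := by
    rw [coroot_single, cartan, hm]
  have hba1 : coroot M b (Pi.single a 1) = -2 * cos (π / m) := by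
    rw [coroot_single, cartan, M.symmetric, hm]
  rcases m with _ | _ | _ | m
  · simp
  · exact absurd rfl h1
  · have hab2 : coroot M a (Pi.single b 1) = 0 := by rw [hab1]; simp
    have hba2 : coroot M b (Pi.single a 1) = 0 := by rw [hba1]; simp
    ext1 v
    have hcomm (v) : geomSimple M a (geomSimple M b v) = geomSimple M b (geomSimple M a v) := by
      simp only [geomSimple_apply, map_sub, map_smul, hab2, hba2]
      module
    simp only [zero_add, Nat.reduceAdd, pow_two, LinearEquiv.mul_apply]
    rw [hcomm, geomSimple_geomSimple, geomSimple_geomSimple]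
    rfl
  · set n := m + 1 + 1 + 1 with hn
    have hnpos : (0 : ℝ) < n := by positivity
    have hn3 : (3 : ℝ) ≤ n := by exact_mod_cast (by omega : 3 ≤ n)
    set θ : ℝ := 2 * (π / n) with hθ
    have hθn : n * θ = 2 * π := by rw [hθ]; field_simp
    have hθ0 : 0 < θ := by positivity
    have hθpi : θ < π := by nlinarith [pi_pos]
    have hsin : sin θ ≠ 0 := (sin_pos_of_pos_of_lt_pi hθ0 hθpi).ne'
    have ht : 2 * cos θ = coroot M a (Pi.single b 1) * coroot M b (Pi.single a 1) - 2 := by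
      rw [hab1, hba1, hθ, cos_two_mul]; ring
    ext1 v
    have key := Module.reflection_mul_reflection_pow_apply (coroot_single_self M a)
      (coroot_single_self M b) n v (2 * cos θ) ht
    change ((geomSimple M a * geomSimple M b) ^ n) v = v
    unfold geomSimple
    rw [key]
    rcases Nat.even_or_odd' n with ⟨k, hk | hk⟩
    · have e1 : ((n : ℤ) - 2) / 2 = (k : ℤ) - 1 := by omega
      have e2 : ((n : ℤ) - 1) / 2 = (k : ℤ) - 1 := by omega
      have hS : (S ℝ ((k : ℤ) - 1)).eval (2 * cos θ) = 0 := by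
        rw [eval_S_eq_div hsin, div_eq_zero_iff]
        left
        have : ((((k : ℤ) - 1 : ℤ) : ℝ) + 1) * θ = π := by
          rw [hk] at hθn
          push_cast at hθn ⊢
          linarith
        rw [this, sin_pi]
      rw [e1, e2, hS]
      simp
    · have e1 : ((n : ℤ) - 1) / 2 = (k : ℤ) := by omega
      have e2 : ((n : ℤ) - 3) / 2 = (k : ℤ) - 1 := by omega
      have e3 : (n : ℤ) / 2 = (k : ℤ) := by omega
      have e4 : ((n : ℤ) - 2) / 2 = (k : ℤ) - 1 := by omega
      have hS : (S ℝ (k : ℤ)).eval (2 * cos θ) + (S ℝ ((k : ℤ) - 1)).eval (2 * cos θ) = 0 := by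
        rw [eval_S_eq_div hsin, eval_S_eq_div hsin, ← add_div, div_eq_zero_iff]
        left
        have : (((k : ℤ) : ℝ) + 1) * θ = 2 * π - ((((k : ℤ) - 1 : ℤ) : ℝ) + 1) * θ := by
          rw [hk] at hθn
          push_cast at hθn ⊢
          linarith
        rw [this, sin_two_pi_sub]
        ring
      rw [e1, e2, e3, e4, hS]
      simp

/-- The geometric representation of a Coxeter group. -/
def geom (cs : CoxeterSystem M W) : W →* ((B → ℝ) ≃ₗ[ℝ] (B → ℝ)) :=
  cs.lift ⟨geomSimple M, isLiftable_geomSimple M⟩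

lemma geom_simple (cs : CoxeterSystem M W) (s : B) : geom cs (cs.simple s) = geomSimple M s :=
  cs.lift_apply_simple _ s

lemma geom_mul_apply (cs : CoxeterSystem M W) (u v : W) (x : B → ℝ) :
    geom cs (u * v) x = geom cs u (geom cs v x) := by
  rw [map_mul, LinearEquiv.mul_apply]

lemma geom_one_apply (cs : CoxeterSystem M W) (x : B → ℝ) : geom cs 1 x = x := by
  rw [map_one]
  rfl

lemma geom_inv_apply_geom (cs : CoxeterSystem M W) (u : W) (x : B → ℝ) :
    geom cs u⁻¹ (geom cs u x) = x := by
  rw [← geom_mul_apply, inv_mul_cancel, geom_one_apply]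

lemma geom_apply_geom_inv (cs : CoxeterSystem M W) (u : W) (x : B → ℝ) :
    geom cs u (geom cs u⁻¹ x) = x := by
  rw [← geom_mul_apply, mul_inv_cancel, geom_one_apply]

lemma geom_simple_apply (cs : CoxeterSystem M W) (s : B) (v : B → ℝ) :
    geom cs (cs.simple s) v = v - coroot M s v • Pi.single s 1 := by
  rw [geom_simple, geomSimple_apply]

lemma geom_simple_single_self (cs : CoxeterSystem M W) (s : B) :
    geom cs (cs.simple s) (Pi.single s 1) = -Pi.single s 1 := by
  rw [geom_simple_apply, coroot_single_self]
  module

/-- On the plane spanned by two simple roots, an alternating word acts through values of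
Chebyshev polynomials. -/
lemma geom_alternatingWord (cs : CoxeterSystem M W) (a b : B) (k : ℕ) :
    geom cs (cs.wordProd (alternatingWord a b k)) (Pi.single a 1) =
      (S ℝ k).eval (2 * cos (π / M a b)) • Pi.single (if Even k then a else b) 1 +
      (S ℝ (k - 1)).eval (2 * cos (π / M a b)) • Pi.single (if Even k then b else a) 1 := by
  induction k with
  | zero => simp [alternatingWord]
  | succ k ih =>
    rw [alternatingWord_succ', cs.wordProd_cons, geom_mul_apply, ih]
    have hrec : (S ℝ ((k : ℤ) + 1)).eval (2 * cos (π / M a b)) =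
        2 * cos (π / M a b) * (S ℝ k).eval (2 * cos (π / M a b)) -
          (S ℝ (k - 1)).eval (2 * cos (π / M a b)) := by
      rw [S_add_one]; simp
    have hba : M b a = M a b := M.symmetric b a
    rcases Nat.even_or_odd k with hk | hk
    · have hk' : ¬ Even (k + 1) := by simpa [Nat.even_add_one] using hk
      simp only [hk, hk', if_true, if_false, geom_simple_apply, map_add, map_smul, coroot_single,
        cartan_self, Nat.cast_add, Nat.cast_one, add_sub_cancel_right, hrec]
      simp only [cartan, hba]
      module
    · have hk1 : ¬ Even k := by simpa using hk
      have hk' : Even (k + 1) := by simpa [Nat.even_add_one] using hk1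
      simp only [hk1, hk', if_true, if_false, geom_simple_apply, map_add, map_smul, coroot_single,
        cartan_self, Nat.cast_add, Nat.cast_one, add_sub_cancel_right, hrec]
      simp only [cartan]
      module

/-- If `ℓ(ws) > ℓ(w)` then `w` maps the simple root of `s` to a nonnegative vector. -/
theorem geom_single_nonneg (cs : CoxeterSystem M W) (w : W) (s : B)
    (h : cs.length w < cs.length (w * cs.simple s)) : 0 ≤ geom cs w (Pi.single s 1) := by
  induction hn : cs.length w using Nat.strong_induction_on generalizing w s with
  | _ n ih =>
  subst hn
  by_cases hw : w = 1
  · subst hw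
    rw [geom_one_apply]
    simp
  obtain ⟨t, ht⟩ := cs.exists_rightDescent_of_ne_one hw
  have hst : s ≠ t := by
    rintro rfl
    exact absurd h (not_lt.mpr ht.le)
  have claim : ∀ (N : ℕ) (v : W) (k : ℕ), cs.length v = N → 1 ≤ k →
      w = v * cs.wordProd (alternatingWord s t k) → cs.length w = cs.length v + k →
      0 ≤ geom cs w (Pi.single s 1) := by
    intro N
    induction N using Nat.strong_induction_on with
    | _ N ihN =>
    intro v k hv hk hw hlen
    have hnext := cs.wordProd_cons (if Even k then t else s) (alternatingWord s t k)
    rw [← alternatingWord_succ'] at hnext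
    by_cases hdesc : cs.length (v * cs.simple (if Even k then t else s)) < cs.length v
    · refine ihN _ (hv ▸ hdesc) (v * cs.simple (if Even k then t else s)) (k + 1) rfl (by omega)
        ?_ ?_
      · rw [hnext, hw, mul_assoc, simple_mul_simple_cancel_left]
      · rcases cs.length_mul_simple v (if Even k then t else s) with h' | h' <;> omega
    have hup1 : cs.length v < cs.length (v * cs.simple (if Even k then t else s)) := by
      rcases cs.length_mul_simple v (if Even k then t else s) with h' | h' <;> omega
    have hup2 : cs.length v < cs.length (v * cs.simple (if Even k then s else t)) := by
      obtain ⟨j, rfl⟩ : ∃ j, k = j + 1 := ⟨k - 1, by omega⟩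
      have hif : (if Even (j + 1) then s else t) = if Even j then t else s := by
        by_cases hj : Even j <;> simp [Nat.even_add_one, hj]
      rw [hif]
      have hle := cs.length_mul_le (v * cs.simple (if Even j then t else s))
        (cs.wordProd (alternatingWord s t j))
      have hle2 := cs.length_wordProd_le (alternatingWord s t j)
      rw [alternatingWord_succ', wordProd_cons, ← mul_assoc] at hw
      rw [← hw] at hle
      rw [length_alternatingWord] at hle2
      omega
    have hk' : M s t = 0 ∨ k < M s t := by
      by_contra! hcon
      have hnot := cs.not_isReduced_alternatingWord t s (m := k + 1)
        (by rw [M.symmetric]; exact hcon.1) (by rw [M.symmetric]; omega)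
      have hle := cs.length_wordProd_le (alternatingWord t s (k + 1))
      rw [CoxeterSystem.IsReduced, length_alternatingWord] at hnot
      rw [length_alternatingWord] at hle
      have heq : w * cs.simple s = v * cs.wordProd (alternatingWord t s (k + 1)) := by
        rw [hw, alternatingWord_succ, List.concat_eq_append, wordProd_append, wordProd_singleton,
          mul_assoc]
      have hle2 := cs.length_mul_le v (cs.wordProd (alternatingWord t s (k + 1)))
      rw [← heq] at hle2
      omega
    have hpos1 := ih (cs.length v) (by omega) v _ hup1 rfl
    have hpos2 := ih (cs.length v) (by omega) v _ hup2 rfl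
    have hmne := M.off_diagonal s t hst
    have hS1 := eval_S_nonneg (M s t) k hmne hk'
    have hS2 := eval_S_nonneg (M s t) (k - 1) hmne (by omega)
    rw [Nat.cast_sub hk] at hS2
    rw [hw, geom_mul_apply, geom_alternatingWord, map_add, map_smul, map_smul]
    exact add_nonneg (smul_nonneg hS1 hpos2) (smul_nonneg (by exact_mod_cast hS2) hpos1)
  refine claim _ (w * cs.simple t) 1 rfl le_rfl ?_ ?_
  · simp [alternatingWord]
  · rcases cs.length_mul_simple w t with h' | h'
    · unfold IsRightDescent at ht
      omega
    · omega

lemma geom_simple_mul_single (cs : CoxeterSystem M W) (w : W) (s : B) :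
    geom cs (w * cs.simple s) (Pi.single s 1) = -geom cs w (Pi.single s 1) := by
  rw [geom_mul_apply, geom_simple_single_self, map_neg]

lemma single_ne_zero (s : B) : (Pi.single s 1 : B → ℝ) ≠ 0 := by
  simp

lemma geom_single_nonpos (cs : CoxeterSystem M W) (w : W) (s : B)
    (h : cs.length (w * cs.simple s) < cs.length w) : geom cs w (Pi.single s 1) ≤ 0 := by
  have := geom_single_nonneg cs (w * cs.simple s) s (by simpa using h)
  rw [geom_simple_mul_single] at this
  exact neg_nonneg.mp this

lemma geom_single_nonneg_iff (cs : CoxeterSystem M W) (w : W) (s : B) :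
    0 ≤ geom cs w (Pi.single s 1) ↔ cs.length w < cs.length (w * cs.simple s) := by
  refine ⟨fun h => ?_, geom_single_nonneg cs w s⟩
  by_contra hcon
  have hlt : cs.length (w * cs.simple s) < cs.length w := by
    rcases cs.length_mul_simple w s with h' | h' <;> omega
  have := le_antisymm (geom_single_nonpos cs w s hlt) h
  exact single_ne_zero s ((geom cs w).map_eq_zero_iff.mp this)

lemma geom_single_nonpos_iff (cs : CoxeterSystem M W) (w : W) (s : B) :
    geom cs w (Pi.single s 1) ≤ 0 ↔ cs.length (w * cs.simple s) < cs.length w := by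
  have := geom_single_nonneg_iff cs (w * cs.simple s) s
  rw [geom_simple_mul_single] at this
  simpa using this

lemma geom_inv_single_nonneg_iff (cs : CoxeterSystem M W) (w : W) (s : B) :
    0 ≤ geom cs w⁻¹ (Pi.single s 1) ↔ cs.length w < cs.length (cs.simple s * w) := by
  rw [geom_single_nonneg_iff, cs.length_inv, ← cs.length_inv (w⁻¹ * _)]
  simp

lemma geom_inv_single_nonpos_iff (cs : CoxeterSystem M W) (w : W) (s : B) :
    geom cs w⁻¹ (Pi.single s 1) ≤ 0 ↔ cs.length (cs.simple s * w) < cs.length w := by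
  rw [geom_single_nonpos_iff, cs.length_inv, ← cs.length_inv (w⁻¹ * _)]
  simp

lemma eq_one_of_geom_apply_eq (cs : CoxeterSystem M W) (w : W)
    (h : ∀ v, geom cs w v = v) : w = 1 := by
  by_contra hw
  obtain ⟨t, ht⟩ := cs.exists_rightDescent_of_ne_one hw
  have h1 := geom_single_nonpos cs w t ht
  rw [h] at h1
  have := h1 t
  simp at this
  linarith

/-- The invariant symmetric form of the geometric representation. -/
def form (M : CoxeterMatrix B) (u v : B → ℝ) : ℝ := ∑ a, u a * coroot M a v

lemma form_single (M : CoxeterMatrix B) (s : B) (v : B → ℝ) :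
    form M (Pi.single s 1) v = coroot M s v := by
  simp [form, Pi.single_apply]

lemma form_comm (M : CoxeterMatrix B) (u v : B → ℝ) : form M u v = form M v u := by
  simp only [form, coroot_apply, Finset.mul_sum]
  rw [Finset.sum_comm]
  refine Finset.sum_congr rfl fun a _ => Finset.sum_congr rfl fun b _ => ?_
  rw [cartan_comm]
  ring

lemma form_sub_smul_right (M : CoxeterMatrix B) (u v x : B → ℝ) (a : ℝ) :
    form M u (v - a • x) = form M u v - a * form M u x := by
  simp only [form, map_sub, map_smul, smul_eq_mul, mul_sub, Finset.sum_sub_distrib,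
    Finset.mul_sum]
  congr 1
  exact Finset.sum_congr rfl fun b _ => by ring

lemma form_sub_smul_left (M : CoxeterMatrix B) (u v x : B → ℝ) (a : ℝ) :
    form M (v - a • x) u = form M v u - a * form M x u := by
  rw [form_comm, form_sub_smul_right, form_comm M u v, form_comm M u x]

lemma form_geom (cs : CoxeterSystem M W) (w : W) (u v : B → ℝ) :
    form M (geom cs w u) (geom cs w v) = form M u v := by
  induction w using cs.simple_induction_left with
  | one => simp only [geom_one_apply]
  | mul_simple_left w s ih =>
    rw [geom_mul_apply, geom_mul_apply, ← ih]
    simp only [geom_simple_apply, form_sub_smul_left, form_sub_smul_right, form_single,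
      coroot_single_self, form_comm M _ (Pi.single s 1)]
    ring

lemma simple_mul_eq_mul_simple (cs : CoxeterSystem M W) {x : W} {s s' : B}
    (h : geom cs x (Pi.single s' 1) = Pi.single s 1) :
    cs.simple s * x = x * cs.simple s' := by
  have : cs.simple s * x * cs.simple s' * x⁻¹ = 1 := by
    apply eq_one_of_geom_apply_eq cs
    intro v
    have h1 : geom cs (x * (cs.simple s' * x⁻¹)) v = geom cs (cs.simple s) v := by
      rw [geom_mul_apply, geom_mul_apply, geom_simple_apply, geom_simple_apply, map_sub, map_smul,
        geom_apply_geom_inv, h, ← form_single, ← form_single, ← h,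
        ← form_geom cs x (Pi.single s' 1), geom_apply_geom_inv]
    rw [show cs.simple s * x * cs.simple s' * x⁻¹ = cs.simple s * (x * (cs.simple s' * x⁻¹)) by
      group, geom_mul_apply, h1, ← geom_mul_apply, cs.simple_mul_simple_self, geom_one_apply]
  have h2 := mul_inv_eq_one.mp this
  simpa using congrArg (· * cs.simple s') h2

/-- The exchange condition in its simplest form. -/
lemma geom_single_eq_single (cs : CoxeterSystem M W) {x : W} {s s' : B}
    (h1 : cs.length x < cs.length (cs.simple s * x))
    (h2 : cs.length (cs.simple s * (x * cs.simple s')) < cs.length (x * cs.simple s')) :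
    geom cs x (Pi.single s' 1) = Pi.single s 1 := by
  rw [← geom_inv_single_nonneg_iff] at h1
  rw [← geom_inv_single_nonpos_iff, mul_inv_rev, cs.inv_simple, geom_mul_apply,
    geom_simple_apply] at h2
  set v := geom cs x⁻¹ (Pi.single s 1) with hv
  have hv' : v = v s' • Pi.single s' 1 := by
    funext r
    by_cases hr : r = s'
    · subst hr; simp
    · have h3 := h1 r
      have h4 := h2 r
      simp [hr] at h3 h4 ⊢
      exact le_antisymm h4 h3
  have hf : form M v v = 2 := by
    rw [hv, form_geom, form_single, coroot_single_self]
  have hsmul (a : ℝ) (u : B → ℝ) : form M (a • Pi.single s' 1) u = a * coroot M s' u := by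
    simp [form, Pi.single_apply]
  have hf2 : form M v v = v s' * v s' * 2 := by
    have h6 : coroot M s' v = v s' * 2 := by
      conv_lhs => rw [hv']
      rw [map_smul, coroot_single_self, smul_eq_mul]
    rw [show form M v v = form M (v s' • Pi.single s' 1) v from congrArg (form M · v) hv', hsmul,
      h6, mul_assoc]
  have h7 : 0 ≤ v s' := h1 s'
  have h8 : v s' = 1 := by nlinarith
  rw [h8, one_smul] at hv'
  rw [← hv', hv, geom_apply_geom_inv]

/-! ### Roots and inversions -/

/-- Roots of the geometric representation. -/
def IsRoot (cs : CoxeterSystem M W) (v : B → ℝ) : Prop :=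
  ∃ w s, v = geom cs w (Pi.single s 1)

lemma isRoot_geom_single (cs : CoxeterSystem M W) (w : W) (s : B) :
    IsRoot cs (geom cs w (Pi.single s 1)) := ⟨w, s, rfl⟩

lemma isRoot_single (cs : CoxeterSystem M W) (s : B) : IsRoot cs (Pi.single s 1) :=
  ⟨1, s, (geom_one_apply cs _).symm⟩

lemma IsRoot.geom {cs : CoxeterSystem M W} {v : B → ℝ} (h : IsRoot cs v) (w : W) :
    IsRoot cs (geom cs w v) := by
  obtain ⟨u, s, rfl⟩ := h
  exact ⟨w * u, s, (geom_mul_apply cs w u _).symm⟩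

lemma IsRoot.ne_zero {cs : CoxeterSystem M W} {v : B → ℝ} (h : IsRoot cs v) : v ≠ 0 := by
  obtain ⟨u, s, rfl⟩ := h
  simp

lemma IsRoot.nonneg_or_nonpos {cs : CoxeterSystem M W} {v : B → ℝ} (h : IsRoot cs v) :
    0 ≤ v ∨ v ≤ 0 := by
  obtain ⟨u, s, rfl⟩ := h
  rcases cs.length_mul_simple u s with h' | h'
  · exact Or.inl (geom_single_nonneg cs u s (by omega))
  · exact Or.inr (geom_single_nonpos cs u s (by omega))

lemma IsRoot.nonneg_of_pos {cs : CoxeterSystem M W} {v : B → ℝ} (h : IsRoot cs v) {r : B}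
    (hr : 0 < v r) : 0 ≤ v :=
  h.nonneg_or_nonpos.resolve_right fun h' => absurd (h' r) (not_le.mpr hr)

lemma geom_simple_coord (cs : CoxeterSystem M W) {r s : B} (h : r ≠ s) (v : B → ℝ) :
    geom cs (cs.simple s) v r = v r := by
  simp [geom_simple_apply, h]

/-- A simple reflection permutes the positive roots other than its own. -/
lemma IsRoot.simple_nonneg {cs : CoxeterSystem M W} {v : B → ℝ} (h : IsRoot cs v)
    (h0 : 0 ≤ v) (s : B) (hne : ∀ a : ℝ, 0 ≤ a → v ≠ a • Pi.single s 1) :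
    0 ≤ CambrianPaper.geom cs (cs.simple s) v := by
  have : ∃ r, r ≠ s ∧ 0 < v r := by
    by_contra! hcon
    refine hne (v s) (h0 s) ?_
    funext r
    by_cases hr : r = s
    · subst hr; simp
    · simpa [hr] using le_antisymm (hcon r hr) (h0 r)
  obtain ⟨r, hr, hpos⟩ := this
  apply (h.geom (cs.simple s)).nonneg_of_pos (r := r)
  rwa [geom_simple_coord cs hr]

/-- Positive roots made negative by `w⁻¹`. -/
structure IsInv (cs : CoxeterSystem M W) (w : W) (v : B → ℝ) : Prop where
  isRoot : IsRoot cs v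
  nonneg : 0 ≤ v
  nonpos : geom cs w⁻¹ v ≤ 0

/-- Positive roots kept positive by `w⁻¹`. -/
structure IsNonInv (cs : CoxeterSystem M W) (w : W) (v : B → ℝ) : Prop where
  isRoot : IsRoot cs v
  nonneg : 0 ≤ v
  nonneg' : 0 ≤ geom cs w⁻¹ v

lemma IsInv.not_isNonInv {cs : CoxeterSystem M W} {w : W} {v : B → ℝ} (h : IsInv cs w v)
    (h' : IsNonInv cs w v) : False :=
  (h.isRoot.geom w⁻¹).ne_zero (le_antisymm h.nonpos h'.nonneg')

lemma not_isInv_one {cs : CoxeterSystem M W} {v : B → ℝ} (h : IsInv cs 1 v) : False :=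
  h.not_isNonInv ⟨h.isRoot, h.nonneg, by rw [inv_one, geom_one_apply]; exact h.nonneg⟩

lemma IsInv.ne_smul {cs : CoxeterSystem M W} {w : W} {v : B → ℝ} (h : IsInv cs w v) {s : B}
    (hs : cs.length w < cs.length (cs.simple s * w)) (a : ℝ) (ha : 0 ≤ a) :
    v ≠ a • Pi.single s 1 := by
  rintro rfl
  refine h.not_isNonInv ⟨h.isRoot, h.nonneg, ?_⟩
  rw [map_smul]
  exact smul_nonneg ha ((geom_inv_single_nonneg_iff cs w s).mpr hs)

lemma IsNonInv.ne_smul {cs : CoxeterSystem M W} {w : W} {v : B → ℝ} (h : IsNonInv cs w v) {s : B}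
    (hs : cs.length (cs.simple s * w) < cs.length w) (a : ℝ) (ha : 0 ≤ a) :
    v ≠ a • Pi.single s 1 := by
  rintro rfl
  refine IsInv.not_isNonInv ⟨h.isRoot, h.nonneg, ?_⟩ h
  rw [map_smul]
  exact smul_nonpos_of_nonneg_of_nonpos ha ((geom_inv_single_nonpos_iff cs w s).mpr hs)

lemma geom_inv_simple_mul (cs : CoxeterSystem M W) (w : W) (s : B) (v : B → ℝ) :
    geom cs (cs.simple s * w)⁻¹ (geom cs (cs.simple s) v) = geom cs w⁻¹ v := by
  rw [← geom_mul_apply]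
  simp

lemma geom_simple_geom_simple (cs : CoxeterSystem M W) (s : B) (v : B → ℝ) :
    geom cs (cs.simple s) (geom cs (cs.simple s) v) = v := by
  rw [← geom_mul_apply, cs.simple_mul_simple_self, geom_one_apply]

lemma IsInv.simple_mul {cs : CoxeterSystem M W} {w : W} {v : B → ℝ} (h : IsInv cs w v) {s : B}
    (hne : ∀ a : ℝ, 0 ≤ a → v ≠ a • Pi.single s 1) :
    IsInv cs (cs.simple s * w) (geom cs (cs.simple s) v) :=
  ⟨h.isRoot.geom _, h.isRoot.simple_nonneg h.nonneg s hne, by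
    rw [geom_inv_simple_mul]; exact h.nonpos⟩

lemma IsNonInv.simple_mul {cs : CoxeterSystem M W} {w : W} {v : B → ℝ} (h : IsNonInv cs w v)
    {s : B} (hne : ∀ a : ℝ, 0 ≤ a → v ≠ a • Pi.single s 1) :
    IsNonInv cs (cs.simple s * w) (geom cs (cs.simple s) v) :=
  ⟨h.isRoot.geom _, h.isRoot.simple_nonneg h.nonneg s hne, by
    rw [geom_inv_simple_mul]; exact h.nonneg'⟩

lemma isInv_mul_simple (cs : CoxeterSystem M W) {x : W} {q : B}
    (h : cs.length x < cs.length (x * cs.simple q)) :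
    IsInv cs (x * cs.simple q) (geom cs x (Pi.single q 1)) := by
  refine ⟨isRoot_geom_single cs x q, geom_single_nonneg cs x q h, ?_⟩
  rw [mul_inv_rev, geom_mul_apply, geom_inv_apply_geom, cs.inv_simple, geom_simple_single_self]
  simp

lemma isNonInv_geom_single (cs : CoxeterSystem M W) {x : W} {q : B}
    (h : cs.length x < cs.length (x * cs.simple q)) :
    IsNonInv cs x (geom cs x (Pi.single q 1)) := by
  refine ⟨isRoot_geom_single cs x q, geom_single_nonneg cs x q h, ?_⟩
  rw [geom_inv_apply_geom]
  simp

lemma IsInv.mul_simple {cs : CoxeterSystem M W} {x : W} {v : B → ℝ} (hv : IsInv cs x v) {q : B}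
    (h : cs.length x < cs.length (x * cs.simple q)) : IsInv cs (x * cs.simple q) v := by
  refine ⟨hv.isRoot, hv.nonneg, ?_⟩
  have h1 : 0 ≤ geom cs (cs.simple q) (-geom cs x⁻¹ v) := by
    have hroot : IsRoot cs (-geom cs x⁻¹ v) := by
      obtain ⟨u, s, rfl⟩ := hv.isRoot
      exact ⟨x⁻¹ * (u * cs.simple s), s, by
        rw [geom_mul_apply, geom_simple_mul_single, map_neg]⟩
    refine hroot.simple_nonneg (by simpa using hv.nonpos) q ?_
    intro a ha heq
    have h2 : v = -(a • geom cs x (Pi.single q 1)) := by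
      rw [← map_smul, ← heq, map_neg, geom_apply_geom_inv, neg_neg]
    have h3 : v ≤ 0 := by
      rw [h2]
      exact neg_nonpos.mpr (smul_nonneg ha (geom_single_nonneg cs x q h))
    exact hv.isRoot.ne_zero (le_antisymm h3 hv.nonneg)
  rw [mul_inv_rev, cs.inv_simple, geom_mul_apply]
  rw [map_neg] at h1
  exact neg_nonneg.mp h1

/-! ### Elements of maximal parabolic subgroups -/

/-- `w` fixes the `r`-th coordinate in the geometric representation; this says that the letter `r`
is not used in reduced words of `w`. -/
def FixesCoord (cs : CoxeterSystem M W) (r : B) (w : W) : Prop :=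
  ∀ v, geom cs w v r = v r

lemma FixesCoord.mul {cs : CoxeterSystem M W} {r : B} {u w : W} (hu : FixesCoord cs r u)
    (hw : FixesCoord cs r w) : FixesCoord cs r (u * w) := fun v => by
  rw [geom_mul_apply, hu, hw]

lemma fixesCoord_one (cs : CoxeterSystem M W) (r : B) : FixesCoord cs r 1 := fun v => by
  rw [geom_one_apply]

lemma fixesCoord_simple (cs : CoxeterSystem M W) {r s : B} (h : r ≠ s) :
    FixesCoord cs r (cs.simple s) := fun v => geom_simple_coord cs h v

lemma FixesCoord.inv {cs : CoxeterSystem M W} {r : B} {w : W} (hw : FixesCoord cs r w) :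
    FixesCoord cs r w⁻¹ := fun v => by
  rw [← hw (geom cs w⁻¹ v), geom_apply_geom_inv]

lemma FixesCoord.length_lt_simple_mul {cs : CoxeterSystem M W} {r : B} {w : W}
    (hw : FixesCoord cs r w) : cs.length w < cs.length (cs.simple r * w) := by
  rw [← geom_inv_single_nonneg_iff]
  exact ((isRoot_single cs r).geom w⁻¹).nonneg_of_pos (r := r) (by rw [hw.inv]; simp)

lemma FixesCoord.length_lt_mul_simple {cs : CoxeterSystem M W} {r : B} {w : W}
    (hw : FixesCoord cs r w) : cs.length w < cs.length (w * cs.simple r) := by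
  rw [← geom_single_nonneg_iff]
  exact ((isRoot_single cs r).geom w).nonneg_of_pos (r := r) (by rw [hw]; simp)

lemma FixesCoord.coord_eq_zero {cs : CoxeterSystem M W} {r : B} {w : W} (hw : FixesCoord cs r w)
    {v : B → ℝ} (hv : IsInv cs w v) : v r = 0 := by
  have h1 := hv.nonpos r
  rw [hw.inv] at h1
  exact le_antisymm h1 (hv.nonneg r)

lemma not_fixesCoord_mul_simple (cs : CoxeterSystem M W) {r : B} {w : W}
    (hw : FixesCoord cs r w) : ¬ FixesCoord cs r (w * cs.simple r) := fun h => by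
  have h1 := h.length_lt_mul_simple
  rw [simple_mul_simple_cancel_right] at h1
  exact absurd hw.length_lt_mul_simple h1.asymm

/-- Induction along a reduced word, read from the left. -/
lemma reduced_induction_left (cs : CoxeterSystem M W) {p : W → Prop} (one : p 1)
    (step : ∀ w s, cs.length w < cs.length (cs.simple s * w) → p w → p (cs.simple s * w))
    (w : W) : p w := by
  induction hn : cs.length w generalizing w with
  | zero => rwa [cs.length_eq_zero_iff.mp hn]
  | succ n ih =>
    obtain ⟨s, hs⟩ := cs.exists_leftDescent_of_ne_one
      (w := w) (by rintro rfl; simp at hn)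
    rw [isLeftDescent_iff] at hs
    have := step (cs.simple s * w) s (by simp; omega) (ih _ (by omega))
    simpa using this

/-- Induction along a reduced word, read from the right. -/
lemma reduced_induction_right (cs : CoxeterSystem M W) {p : W → Prop} (one : p 1)
    (step : ∀ w s, cs.length w < cs.length (w * cs.simple s) → p w → p (w * cs.simple s))
    (w : W) : p w := by
  induction hn : cs.length w generalizing w with
  | zero => rwa [cs.length_eq_zero_iff.mp hn]
  | succ n ih =>
    obtain ⟨s, hs⟩ := cs.exists_rightDescent_of_ne_one
      (w := w) (by rintro rfl; simp at hn)
    rw [isRightDescent_iff] at hs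
    have := step (w * cs.simple s) s (by simp; omega) (ih _ (by omega))
    simpa using this

lemma fixesCoord_of_isInv (cs : CoxeterSystem M W) (r : B) (w : W)
    (h : ∀ v, IsInv cs w v → v r = 0) : FixesCoord cs r w := by
  induction w using reduced_induction_right cs with
  | one => exact fixesCoord_one cs r
  | step w q hq ih =>
    have hw := ih fun v hv => h v (hv.mul_simple hq)
    refine hw.mul (fixesCoord_simple cs ?_)
    rintro rfl
    have := h _ (isInv_mul_simple cs hq)
    rw [hw] at this
    simp at this

/-- If no reduced word of `w` uses a neighbour of `s` and `s` is not a left descent of `w`, then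
`w` does not involve `s` either, and fixes the simple root of `s`. -/
lemma fixesCoord_of_neighbours (cs : CoxeterSystem M W) (s : B) (w : W)
    (h : ∀ r, r ≠ s → cartan M s r ≠ 0 → FixesCoord cs r w)
    (hs : cs.length w < cs.length (cs.simple s * w)) :
    FixesCoord cs s w ∧ geom cs w (Pi.single s 1) = Pi.single s 1 := by
  induction w using reduced_induction_left cs with
  | one => exact ⟨fixesCoord_one cs s, geom_one_apply cs _⟩
  | step w q hq ih =>
    have hqs : s ≠ q := by
      rintro rfl
      simp at hs
      omega
    have hq0 : cartan M q s = 0 := by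
      by_contra hne
      rw [cartan_comm] at hne
      have := (h q hqs.symm hne).length_lt_simple_mul
      simp at this
      omega
    have hfix : geom cs (cs.simple q) (Pi.single s 1) = Pi.single s 1 := by
      rw [geom_simple_apply, coroot_single, hq0]
      simp
    have hw := ih (fun r hr hne => by
        have hrq : r ≠ q := by
          rintro rfl
          rw [cartan_comm] at hq0
          exact hne hq0
        have := (fixesCoord_simple cs hrq).mul (h r hr hne)
        simpa using this) (by
      rw [← geom_inv_single_nonneg_iff] at hs ⊢
      rwa [mul_inv_rev, geom_mul_apply, cs.inv_simple, hfix] at hs)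
    exact ⟨(fixesCoord_simple cs hqs).mul hw.1, by rw [geom_mul_apply, hw.2, hfix]⟩

lemma fixesCoord_of_geom_single (cs : CoxeterSystem M W) (s : B) (w : W)
    (hw : FixesCoord cs s w)
    (h : ∀ r, r ≠ s → cartan M s r ≠ 0 → geom cs w (Pi.single s 1) r = 0)
    (r : B) (hr : r ≠ s) (hrs : cartan M s r ≠ 0) : FixesCoord cs r w := by
  induction w using reduced_induction_right cs generalizing r with
  | one => exact fixesCoord_one cs r
  | step w q hq ih =>
    have hqs : s ≠ q := by
      rintro rfl
      have := hw.length_lt_mul_simple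
      simp at this
      omega
    have hw' : FixesCoord cs s w := by
      simpa using hw.mul (fixesCoord_simple cs hqs)
    have heq : geom cs (w * cs.simple q) (Pi.single s 1) =
        geom cs w (Pi.single s 1) + (-cartan M s q) • geom cs w (Pi.single q 1) := by
      rw [geom_mul_apply, geom_simple_apply, coroot_single, map_sub, map_smul, cartan_comm M q]
      module
    have hc : 0 ≤ -cartan M s q := by linarith [cartan_nonpos M hqs]
    have hpos1 := geom_single_nonneg cs w q hq
    have hpos2 := geom_single_nonneg cs w s hw'.length_lt_mul_simple
    have hsum (r) (hr : r ≠ s) (hrs : cartan M s r ≠ 0) :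
        geom cs w (Pi.single s 1) r = 0 ∧ -cartan M s q * geom cs w (Pi.single q 1) r = 0 := by
      have h1 := h r hr hrs
      rw [heq] at h1
      simp only [Pi.add_apply, Pi.smul_apply, smul_eq_mul] at h1
      have h2 := hpos2 r
      have h3 := mul_nonneg hc (hpos1 r)
      simp only [Pi.zero_apply] at h2
      constructor <;> linarith
    have ihw := ih hw' fun r hr hrs => (hsum r hr hrs).1
    refine (ihw r hr hrs).mul (fixesCoord_simple cs ?_)
    rintro rfl
    have h1 := (hsum r hr hrs).2
    rw [ihw r hr hrs] at h1
    simp [hrs] at h1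

/-- The pairing of `v` with minus the coroot of `s`, restricted to the letters of `c`. -/
def nbrSum (M : CoxeterMatrix B) (c : List B) (s : B) (v : B → ℝ) : ℝ :=
  (c.map fun r => -cartan M s r * v r).sum

/-- The skew-symmetric form attached to the Coxeter word `c`. -/
def omega (M : CoxeterMatrix B) : List B → (B → ℝ) → (B → ℝ) → ℝ
  | [], _, _ => 0
  | s :: c, u, v => u s * nbrSum M c s v - v s * nbrSum M c s u + omega M c u v

lemma nbrSum_add (M : CoxeterMatrix B) (c : List B) (s : B) (u v : B → ℝ) :
    nbrSum M c s (u + v) = nbrSum M c s u + nbrSum M c s v := by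
  simp only [nbrSum, Pi.add_apply, mul_add, List.sum_map_add]

lemma nbrSum_smul (M : CoxeterMatrix B) (c : List B) (s : B) (a : ℝ) (v : B → ℝ) :
    nbrSum M c s (a • v) = a * nbrSum M c s v := by
  induction c with
  | nil => simp [nbrSum]
  | cons r c ih =>
    simp only [nbrSum, List.map_cons, List.sum_cons, Pi.smul_apply, smul_eq_mul] at ih ⊢
    rw [ih]; ring

lemma nbrSum_congr (M : CoxeterMatrix B) (c : List B) (s : B) {u v : B → ℝ}
    (h : ∀ r ∈ c, u r = v r) : nbrSum M c s u = nbrSum M c s v := by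
  unfold nbrSum
  congr 1
  exact List.map_congr_left fun r hr => by rw [h r hr]

lemma nbrSum_zero (M : CoxeterMatrix B) (c : List B) (s : B) : nbrSum M c s 0 = 0 := by
  simpa using nbrSum_smul M c s 0 0

lemma nbrSum_single_self (M : CoxeterMatrix B) {c : List B} {s : B} (hs : s ∉ c) :
    nbrSum M c s (Pi.single s 1) = 0 := by
  rw [← nbrSum_zero M c s]
  exact nbrSum_congr M c s fun r hr => by
    rw [Pi.single_eq_of_ne (by rintro rfl; exact hs hr)]; rfl

lemma nbrSum_nonneg (M : CoxeterMatrix B) {c : List B} {s : B} (hs : s ∉ c) {v : B → ℝ}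
    (hv : 0 ≤ v) : 0 ≤ nbrSum M c s v := by
  refine List.sum_nonneg ?_
  simp only [List.mem_map]
  rintro x ⟨r, hr, rfl⟩
  have := cartan_nonpos M (a := s) (b := r) (by rintro rfl; exact hs hr)
  exact mul_nonneg (by linarith) (hv r)

lemma nbrSum_eq_zero (M : CoxeterMatrix B) {c : List B} {s : B} (hs : s ∉ c) {v : B → ℝ}
    (hv : 0 ≤ v) (h : nbrSum M c s v ≤ 0) (r : B) (hr : r ∈ c) (hrs : cartan M s r ≠ 0) :
    v r = 0 := by
  induction c with
  | nil => simp at hr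
  | cons q c ih =>
    have hs' : s ∉ c := fun h => hs (List.mem_cons_of_mem _ h)
    have h1 := nbrSum_nonneg M hs' hv
    have hsq : s ≠ q := by rintro rfl; simp at hs
    have h2 := cartan_nonpos M hsq
    have h3 : 0 ≤ -cartan M s q * v q := mul_nonneg (by linarith) (hv q)
    have h4 : nbrSum M (q :: c) s v = -cartan M s q * v q + nbrSum M c s v := by
      simp [nbrSum]
    rcases List.mem_cons.mp hr with rfl | hr
    · have : -cartan M s r * v r = 0 := by linarith
      rcases mul_eq_zero.mp this with h | h
      · exact absurd (neg_eq_zero.mp h) hrs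
      · exact h
    · exact ih hs' (by linarith) hr

lemma omega_congr (M : CoxeterMatrix B) (c : List B) {u u' v v' : B → ℝ}
    (hu : ∀ r ∈ c, u r = u' r) (hv : ∀ r ∈ c, v r = v' r) :
    omega M c u v = omega M c u' v' := by
  induction c with
  | nil => rfl
  | cons s c ih =>
    have hu' : ∀ r ∈ c, u r = u' r := fun r hr => hu r (List.mem_cons_of_mem _ hr)
    have hv' : ∀ r ∈ c, v r = v' r := fun r hr => hv r (List.mem_cons_of_mem _ hr)
    simp only [omega]
    rw [ih hu' hv', hu s (by simp), hv s (by simp), nbrSum_congr M c s hu',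
      nbrSum_congr M c s hv']

lemma omega_zero_left (M : CoxeterMatrix B) (c : List B) (v : B → ℝ) : omega M c 0 v = 0 := by
  induction c with
  | nil => rfl
  | cons s c ih => simp [omega, ih, nbrSum_zero]

lemma omega_zero_right (M : CoxeterMatrix B) (c : List B) (v : B → ℝ) : omega M c v 0 = 0 := by
  induction c with
  | nil => rfl
  | cons s c ih => simp [omega, ih, nbrSum_zero]

lemma omega_append_singleton (M : CoxeterMatrix B) (c : List B) (s : B) (u v : B → ℝ) :
    omega M (c ++ [s]) u v =
      omega M c u v + nbrSum M c s u * v s - nbrSum M c s v * u s := by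
  induction c with
  | nil => simp [omega, nbrSum]
  | cons q c ih =>
    have h (x : B → ℝ) : nbrSum M (c ++ [s]) q x = nbrSum M c q x - cartan M q s * x s := by
      simp [nbrSum, sub_eq_add_neg]
    have h' (x : B → ℝ) : nbrSum M (q :: c) s x = -cartan M s q * x q + nbrSum M c s x := by
      simp [nbrSum]
    simp only [List.cons_append, omega, ih, h, h', cartan_comm M s q]
    ring

lemma nbrSum_reverse (M : CoxeterMatrix B) (c : List B) (s : B) (v : B → ℝ) :
    nbrSum M c.reverse s v = nbrSum M c s v := by
  unfold nbrSum
  rw [List.map_reverse, List.sum_reverse]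

lemma omega_reverse (M : CoxeterMatrix B) (c : List B) (u v : B → ℝ) :
    omega M c.reverse u v = -omega M c u v := by
  induction c with
  | nil => simp [omega]
  | cons s c ih =>
    simp only [List.reverse_cons, omega_append_singleton, omega, ih, nbrSum_reverse]
    ring

lemma omega_single_right (M : CoxeterMatrix B) {c : List B} {s : B} (hs : s ∉ c) (v : B → ℝ) :
    omega M (s :: c) v (Pi.single s 1) = -nbrSum M c s v := by
  have : omega M c v (Pi.single s 1) = 0 := by
    rw [← omega_zero_right M c v]
    exact omega_congr M c (fun _ _ => rfl) fun r hr => by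
      rw [Pi.single_eq_of_ne (by rintro rfl; exact hs hr)]; rfl
  simp [omega, this, nbrSum_single_self M hs]

lemma omega_append_single_right (M : CoxeterMatrix B) {c : List B} {s : B} (hs : s ∉ c)
    (v : B → ℝ) : omega M (c ++ [s]) v (Pi.single s 1) = nbrSum M c s v := by
  have : omega M c v (Pi.single s 1) = 0 := by
    rw [← omega_zero_right M c v]
    exact omega_congr M c (fun _ _ => rfl) fun r hr => by
      rw [Pi.single_eq_of_ne (by rintro rfl; exact hs hr)]; rfl
  simp [omega_append_singleton, this, nbrSum_single_self M hs]

lemma omega_single_left (M : CoxeterMatrix B) {c : List B} {s : B} (hs : s ∉ c) (v : B → ℝ) :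
    omega M (s :: c) (Pi.single s 1) v = nbrSum M c s v := by
  have : omega M c (Pi.single s 1) v = 0 := by
    rw [← omega_zero_left M c v]
    exact omega_congr M c (fun r hr => by
      rw [Pi.single_eq_of_ne (by rintro rfl; exact hs hr)]; rfl) fun _ _ => rfl
  simp [omega, this, nbrSum_single_self M hs]

/-- A word listing every letter exactly once. -/
def IsComplete (c : List B) : Prop := c.Nodup ∧ ∀ b, b ∈ c

lemma IsComplete.not_mem {s : B} {c : List B} (h : IsComplete (s :: c)) : s ∉ c :=
  (List.nodup_cons.mp h.1).1

lemma IsComplete.mem {s : B} {c : List B} (h : IsComplete (s :: c)) {r : B} (hr : r ≠ s) :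
    r ∈ c := (List.mem_cons.mp (h.2 r)).resolve_left hr

lemma IsComplete.rotate {s : B} {c : List B} (h : IsComplete (s :: c)) :
    IsComplete (c ++ [s]) := by
  have hp : (s :: c).Perm (c ++ [s]) := (List.perm_append_singleton s c).symm
  exact ⟨hp.nodup_iff.mp h.1, fun b => hp.mem_iff.mp (h.2 b)⟩

lemma coroot_eq_nbrSum {s : B} {c : List B} (h : IsComplete (s :: c)) (v : B → ℝ) :
    coroot M s v = 2 * v s - nbrSum M c s v := by
  have h1 : ∑ b, cartan M s b * v b = ((s :: c).map fun b => cartan M s b * v b).sum := by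
    rw [← List.sum_toFinset _ h.1]
    congr 1
    ext b
    simpa using h.2 b
  have h2 : (c.map fun b => cartan M s b * v b).sum = -nbrSum M c s v := by
    have := nbrSum_smul M c s (-1) v
    rw [neg_one_mul] at this
    rw [← this]
    simp [nbrSum]
  rw [coroot_apply, h1, List.map_cons, List.sum_cons, h2, cartan_self]
  ring

lemma nbrSum_geom_simple (cs : CoxeterSystem M W) {s : B} {c : List B} (hs : s ∉ c)
    (v : B → ℝ) : nbrSum M c s (geom cs (cs.simple s) v) = nbrSum M c s v :=
  nbrSum_congr M c s fun r hr => geom_simple_coord cs (by rintro rfl; exact hs hr) v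

lemma omega_geom_simple (cs : CoxeterSystem M W) {s : B} {c : List B}
    (h : IsComplete (s :: c)) (u v : B → ℝ) :
    omega M (c ++ [s]) (geom cs (cs.simple s) u) (geom cs (cs.simple s) v) =
      omega M (s :: c) u v := by
  have h1 (x : B → ℝ) : geom cs (cs.simple s) x s = nbrSum M c s x - x s := by
    rw [geom_simple_apply, coroot_eq_nbrSum h]
    simp only [Pi.sub_apply, Pi.smul_apply, Pi.single_eq_same, smul_eq_mul]
    ring
  have h2 (x : B → ℝ) (r : B) (hr : r ∈ c) : geom cs (cs.simple s) x r = x r :=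
    geom_simple_coord cs (by rintro rfl; exact h.not_mem hr) x
  rw [omega_append_singleton, nbrSum_geom_simple cs h.not_mem, nbrSum_geom_simple cs h.not_mem,
    h1, h1, omega_congr M c (h2 u) (h2 v), omega]
  ring

/-- Greedily strip the letter `s` from the left of `w`. -/
def strip (cs : CoxeterSystem M W) (w : W) (s : B) : W :=
  if cs.length (cs.simple s * w) < cs.length w then cs.simple s * w else w

/-- The letters taken by a greedy pass. -/
def taken (cs : CoxeterSystem M W) : List B → W → List B
  | [], _ => []
  | s :: c, w =>
    if cs.length (cs.simple s * w) < cs.length w then s :: taken cs c (cs.simple s * w)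
    else taken cs c w

lemma pass_eq (cs : CoxeterSystem M W) (c : List B) (u : W) :
    pass cs c u = (taken cs c u, c.foldl (strip cs) u) := by
  have h : ∀ (l : List B) (u : W), c.foldl (fun p q =>
      if cs.length (cs.simple q * p.2) < cs.length p.2 then (p.1 ++ [q], cs.simple q * p.2)
      else p) (l, u) = (l ++ taken cs c u, c.foldl (strip cs) u) := by
    induction c with
    | nil => simp [taken]
    | cons s c ih =>
      intro l u
      simp only [List.foldl_cons, taken, strip]
      split_ifs
      · rw [ih]; simp
      · rw [ih]
  exact h [] u

lemma remainder_succ (cs : CoxeterSystem M W) (c : List B) (w : W) (n : ℕ) :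
    remainder cs c w (n + 1) = c.foldl (strip cs) (remainder cs c w n) := by
  rw [remainder, pass_eq]

lemma factor_eq (cs : CoxeterSystem M W) (c : List B) (w : W) (n : ℕ) :
    factor cs c w n = taken cs c (remainder cs c w n) := by
  rw [factor, pass_eq]

lemma strip_of_lt (cs : CoxeterSystem M W) {w : W} {s : B}
    (h : cs.length (cs.simple s * w) < cs.length w) : strip cs w s = cs.simple s * w := if_pos h

lemma strip_of_gt (cs : CoxeterSystem M W) {w : W} {s : B}
    (h : cs.length w < cs.length (cs.simple s * w)) : strip cs w s = w := if_neg h.not_gt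

lemma lt_or_gt_simple_mul (cs : CoxeterSystem M W) (w : W) (s : B) :
    cs.length (cs.simple s * w) < cs.length w ∨ cs.length w < cs.length (cs.simple s * w) := by
  rcases cs.length_simple_mul w s with h | h <;> omega

lemma remainder_rotate (cs : CoxeterSystem M W) (s : B) (c : List B) (w : W) (n : ℕ) :
    remainder cs (c ++ [s]) (strip cs w s) n = strip cs (remainder cs (s :: c) w n) s := by
  induction n with
  | zero => rfl
  | succ n ih => rw [remainder_succ, ih, remainder_succ]; simp

lemma taken_subset (cs : CoxeterSystem M W) (c : List B) (w : W) {q : B}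
    (h : q ∈ taken cs c w) : q ∈ c := by
  induction c generalizing w with
  | nil => simp [taken] at h
  | cons s c ih =>
    simp only [taken] at h
    split_ifs at h
    · rcases List.mem_cons.mp h with rfl | h
      · simp
      · exact List.mem_cons_of_mem _ (ih _ h)
    · exact List.mem_cons_of_mem _ (ih _ h)

lemma taken_cons (cs : CoxeterSystem M W) (c : List B) (s : B) (w : W) :
    taken cs (s :: c) w = (if cs.length (cs.simple s * w) < cs.length w then [s] else []) ++
      taken cs c (strip cs w s) := by
  simp only [taken, strip]
  split_ifs <;> simp

lemma taken_append (cs : CoxeterSystem M W) (c : List B) (s : B) (w : W) :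
    taken cs (c ++ [s]) w = taken cs c w ++
      if cs.length (cs.simple s * c.foldl (strip cs) w) < cs.length (c.foldl (strip cs) w)
      then [s] else [] := by
  induction c generalizing w with
  | nil => simp only [List.nil_append, taken]; rfl
  | cons q c ih =>
    rw [List.cons_append, taken_cons, ih, taken_cons, List.append_assoc]
    rfl

lemma isSortable_cons_iff (cs : CoxeterSystem M W) {s : B} {c : List B} (hs : s ∉ c) (w : W) :
    IsSortable cs (s :: c) w ↔ IsSortable cs (c ++ [s]) (strip cs w s) ∧
      (cs.length (cs.simple s * remainder cs (s :: c) w 1) < cs.length (remainder cs (s :: c) w 1) →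
        cs.length (cs.simple s * w) < cs.length w) := by
  set R := remainder cs (s :: c) w with hR
  set T : ℕ → List B := fun n => taken cs c (strip cs (R n) s) with hT
  set D : ℕ → Prop := fun n => cs.length (cs.simple s * R n) < cs.length (R n) with hD
  have hTs (n : ℕ) : s ∉ T n := fun h => hs (taken_subset cs c _ h)
  have h1 (n : ℕ) (q : B) : q ∈ factor cs (s :: c) w n ↔ (q = s ∧ D n) ∨ q ∈ T n := by
    rw [factor_eq, taken_cons, List.mem_append]
    refine or_congr ?_ Iff.rfl
    rw [← hR]
    split_ifs with h <;> simp [hD, h]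
  have h2 (n : ℕ) (q : B) : q ∈ factor cs (c ++ [s]) (strip cs w s) n ↔
      (q = s ∧ D (n + 1)) ∨ q ∈ T n := by
    rw [factor_eq, taken_append, List.mem_append, or_comm, remainder_rotate]
    have h3 : c.foldl (strip cs) (strip cs (R n) s) = R (n + 1) := by
      rw [hR, remainder_succ]; rfl
    refine or_congr ?_ Iff.rfl
    rw [← hR, h3]
    split_ifs with h <;> simp [hD, h]
  have h0 : (cs.length (cs.simple s * w) < cs.length w) = D 0 := rfl
  have h0' : (cs.length (cs.simple s * R 1) < cs.length (R 1)) = D 1 := rfl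
  rw [h0, h0']
  unfold IsSortable
  simp only [h1, h2]
  constructor
  · intro h
    have hD (n : ℕ) (hn : D (n + 1)) : D n := by
      rcases h n s (Or.inl ⟨rfl, hn⟩) with h | h
      · exact h.2
      · exact absurd h (hTs n)
    refine ⟨?_, hD 0⟩
    rintro n q (⟨rfl, hq⟩ | hq)
    · exact Or.inl ⟨rfl, hD _ hq⟩
    · rcases h n q (Or.inr hq) with ⟨rfl, _⟩ | h
      · exact absurd hq (hTs _)
      · exact Or.inr h
  · rintro ⟨h, h01⟩
    have hD (n : ℕ) (hn : D (n + 1)) : D n := by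
      rcases n with _ | n
      · exact h01 hn
      · rcases h n s (Or.inl ⟨rfl, hn⟩) with h | h
        · exact h.2
        · exact absurd h (hTs n)
    rintro n q (⟨rfl, hq⟩ | hq)
    · exact Or.inl ⟨rfl, hD _ hq⟩
    · rcases h n q (Or.inr hq) with ⟨rfl, _⟩ | h
      · exact absurd hq (hTs _)
      · exact Or.inr h

/-- If `s` is a left descent of `w`, sortability is transported by rotating `c`. -/
lemma isSortable_cons_of_lt (cs : CoxeterSystem M W) {s : B} {c : List B} (hs : s ∉ c) {w : W}
    (h : cs.length (cs.simple s * w) < cs.length w) :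
    IsSortable cs (s :: c) w ↔ IsSortable cs (c ++ [s]) (cs.simple s * w) := by
  rw [isSortable_cons_iff cs hs, strip_of_lt cs h]
  simp [h]

lemma length_strip_le (cs : CoxeterSystem M W) (w : W) (s : B) :
    cs.length (strip cs w s) ≤ cs.length w := by
  unfold strip
  split_ifs with h
  · exact h.le
  · exact le_rfl

lemma length_foldl_strip_le (cs : CoxeterSystem M W) (c : List B) (w : W) :
    cs.length (c.foldl (strip cs) w) ≤ cs.length w := by
  induction c generalizing w with
  | nil => simp
  | cons s c ih => exact (ih _).trans (length_strip_le cs w s)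

lemma length_foldl_strip_lt (cs : CoxeterSystem M W) {c : List B} {w : W} {q : B} (hq : q ∈ c)
    (h : cs.length (cs.simple q * w) < cs.length w) :
    cs.length (c.foldl (strip cs) w) < cs.length w := by
  induction c with
  | nil => simp at hq
  | cons s c ih =>
    by_cases hs : cs.length (cs.simple s * w) < cs.length w
    · rw [List.foldl_cons, strip_of_lt cs hs]
      exact (length_foldl_strip_le cs c _).trans_lt hs
    · rw [List.foldl_cons, strip, if_neg hs]
      rcases List.mem_cons.mp hq with rfl | hq
      · exact absurd h hs
      · exact ih hq

lemma length_foldl_strip_lt_of_ne_one (cs : CoxeterSystem M W) {c : List B} (hc : IsComplete c)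
    {w : W} (hw : w ≠ 1) : cs.length (c.foldl (strip cs) w) < cs.length w := by
  obtain ⟨q, hq⟩ := cs.exists_leftDescent_of_ne_one hw
  exact length_foldl_strip_lt cs (hc.2 q) hq

/-- Induction by cyclically rotating a word for a Coxeter element and stripping letters. -/
lemma rotation_induction (cs : CoxeterSystem M W) {p : List B → W → Prop}
    (one : ∀ c, IsComplete c → p c 1)
    (desc : ∀ s c w, IsComplete (s :: c) → cs.length (cs.simple s * w) < cs.length w →
      p (c ++ [s]) (cs.simple s * w) → p (s :: c) w)
    (asc : ∀ s c w, IsComplete (s :: c) → cs.length w < cs.length (cs.simple s * w) →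
      p (c ++ [s]) w → p (s :: c) w)
    {c : List B} (hc : IsComplete c) (w : W) : p c w := by
  have hstrip : ∀ s c w, IsComplete (s :: c) → p (c ++ [s]) (strip cs w s) → p (s :: c) w := by
    intro s c w hc h
    rcases lt_or_gt_simple_mul cs w s with h' | h'
    · exact desc s c w hc h' (by rwa [strip_of_lt cs h'] at h)
    · exact asc s c w hc h' (by rwa [strip_of_gt cs h'] at h)
  have hrot : ∀ (l₁ l₂ : List B) (u : W), IsComplete (l₁ ++ l₂) →
      p (l₂ ++ l₁) (l₁.foldl (strip cs) u) → p (l₁ ++ l₂) u := by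
    intro l₁
    induction l₁ with
    | nil => intro l₂ u _ h; simpa using h
    | cons s l₁ ih =>
      intro l₂ u hc h
      refine hstrip s (l₁ ++ l₂) u hc ?_
      rw [List.append_assoc]
      refine ih (l₂ ++ [s]) _ ?_ ?_
      · have := IsComplete.rotate (c := l₁ ++ l₂) hc
        rwa [List.append_assoc] at this
      · simpa using h
  induction hn : cs.length w using Nat.strong_induction_on generalizing w with
  | _ n ih =>
    by_cases hw : w = 1
    · rw [hw]; exact one c hc
    · have := hrot c [] w (by simpa using hc) (ih _ (hn ▸ length_foldl_strip_lt_of_ne_one cs hc hw) _ rfl)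
      simpa using this

lemma FixesCoord.strip {cs : CoxeterSystem M W} {s q : B} (hq : s ≠ q) {w : W}
    (hw : FixesCoord cs s w) : FixesCoord cs s (strip cs w q) := by
  unfold CambrianPaper.strip
  split_ifs
  · exact (fixesCoord_simple cs hq).mul hw
  · exact hw

lemma FixesCoord.of_strip {cs : CoxeterSystem M W} {s q : B} (hq : s ≠ q) {w : W}
    (hw : FixesCoord cs s (CambrianPaper.strip cs w q)) : FixesCoord cs s w := by
  unfold CambrianPaper.strip at hw
  split_ifs at hw
  · simpa using (fixesCoord_simple cs hq).mul hw
  · exact hw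

lemma fixesCoord_foldl_strip (cs : CoxeterSystem M W) {s : B} {c : List B} (hs : s ∉ c) {w : W} :
    FixesCoord cs s (c.foldl (strip cs) w) ↔ FixesCoord cs s w := by
  induction c generalizing w with
  | nil => simp
  | cons q c ih =>
    rw [List.mem_cons, not_or] at hs
    rw [List.foldl_cons, ih hs.2]
    exact ⟨fun h => h.of_strip hs.1, fun h => h.strip hs.1⟩

lemma length_remainder_le (cs : CoxeterSystem M W) {c : List B} (hc : IsComplete c) (w : W)
    (n : ℕ) : remainder cs c w n = 1 ∨ cs.length (remainder cs c w n) + n ≤ cs.length w := by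
  induction n with
  | zero => exact Or.inr le_rfl
  | succ n ih =>
    rw [remainder_succ]
    rcases ih with h | h
    · left
      have := length_foldl_strip_le cs c (remainder cs c w n)
      rw [h, cs.length_one, Nat.le_zero, cs.length_eq_zero_iff] at this
      rwa [h]
    · by_cases h1 : remainder cs c w n = 1
      · left
        have := length_foldl_strip_le cs c (remainder cs c w n)
        rw [h1, cs.length_one, Nat.le_zero, cs.length_eq_zero_iff] at this
        rwa [h1]
      · have := length_foldl_strip_lt_of_ne_one cs hc h1
        right; omega

/-- If `s` is not a left descent of `w`, sortability forces `w` into the parabolic subgroup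
omitting `s`. -/
lemma isSortable_cons_of_gt (cs : CoxeterSystem M W) {s : B} {c : List B}
    (hc : IsComplete (s :: c)) {w : W} (h : cs.length w < cs.length (cs.simple s * w)) :
    IsSortable cs (s :: c) w ↔ IsSortable cs (c ++ [s]) w ∧ FixesCoord cs s w := by
  constructor
  · intro hsort
    refine ⟨by have := ((isSortable_cons_iff cs hc.not_mem w).mp hsort).1
               rwa [strip_of_gt cs h] at this, ?_⟩
    have hD (n : ℕ) : cs.length (remainder cs (s :: c) w n) <
        cs.length (cs.simple s * remainder cs (s :: c) w n) := by
      induction n with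
      | zero => exact h
      | succ n ih =>
        refine (lt_or_gt_simple_mul cs _ s).resolve_left fun hlt => ?_
        have h1 := hsort n s (by rw [factor_eq, taken_cons, if_pos hlt]; simp)
        rw [factor_eq, taken_cons, if_neg ih.not_gt, List.nil_append] at h1
        exact hc.not_mem (taken_subset cs c _ h1)
    have hF (n : ℕ) : FixesCoord cs s (remainder cs (s :: c) w n) → FixesCoord cs s w := by
      induction n with
      | zero => exact id
      | succ n ih =>
        intro h'
        rw [remainder_succ, List.foldl_cons, strip_of_gt cs (hD n),
          fixesCoord_foldl_strip cs hc.not_mem] at h'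
        exact ih h'
    refine hF (cs.length w + 1) ?_
    rcases length_remainder_le cs hc w (cs.length w + 1) with h1 | h1
    · rw [h1]; exact fixesCoord_one cs s
    · omega
  · rintro ⟨h1, h2⟩
    rw [isSortable_cons_iff cs hc.not_mem, strip_of_gt cs h]
    refine ⟨h1, fun hlt => ?_⟩
    rw [remainder_succ, List.foldl_cons] at hlt
    change cs.length (cs.simple s * List.foldl (strip cs) (strip cs w s) c) < _ at hlt
    rw [strip_of_gt cs h] at hlt
    have := ((fixesCoord_foldl_strip cs hc.not_mem).mpr h2).length_lt_simple_mul
    change _ < cs.length (List.foldl (strip cs) (strip cs w s) c) at hlt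
    rw [strip_of_gt cs h] at hlt
    omega

lemma isSortable_one (cs : CoxeterSystem M W) (c : List B) : IsSortable cs c 1 := by
  have h : ∀ c : List B, taken cs c 1 = [] := by
    intro c
    induction c with
    | nil => rfl
    | cons s c ih => simp [taken, ih]
  have h2 (n : ℕ) : remainder cs c 1 n = 1 := by
    induction n with
    | zero => rfl
    | succ n ih =>
      rw [remainder_succ, ih]
      have := length_foldl_strip_le cs c 1
      rwa [cs.length_one, Nat.le_zero, cs.length_eq_zero_iff] at this
  intro n q hq
  rw [factor_eq, h2, h] at hq
  simp at hq

lemma omega_add_left (M : CoxeterMatrix B) (c : List B) (u u' v : B → ℝ) :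
    omega M c (u + u') v = omega M c u v + omega M c u' v := by
  induction c with
  | nil => simp [omega]
  | cons s c ih => simp only [omega, ih, nbrSum_add, Pi.add_apply]; ring

lemma omega_smul_left (M : CoxeterMatrix B) (c : List B) (a : ℝ) (u v : B → ℝ) :
    omega M c (a • u) v = a * omega M c u v := by
  induction c with
  | nil => simp [omega]
  | cons s c ih => simp only [omega, ih, nbrSum_smul, Pi.smul_apply, smul_eq_mul]; ring

lemma omega_swap (M : CoxeterMatrix B) (c : List B) (u v : B → ℝ) :
    omega M c u v = -omega M c v u := by
  induction c with
  | nil => simp [omega]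
  | cons s c ih => simp only [omega, ih]; ring

lemma omega_self (M : CoxeterMatrix B) (c : List B) (u : B → ℝ) : omega M c u u = 0 := by
  linarith [omega_swap M c u u]

lemma omega_smul_right (M : CoxeterMatrix B) (c : List B) (a : ℝ) (u v : B → ℝ) :
    omega M c u (a • v) = a * omega M c u v := by
  rw [omega_swap, omega_smul_left, omega_swap M c v u]; ring

lemma omega_rotate_of_nbrSum_eq_zero (M : CoxeterMatrix B) (c : List B) {s : B} {u : B → ℝ}
    (h : u s = 0) (h' : nbrSum M c s u = 0) (v : B → ℝ) :
    omega M (c ++ [s]) u v = omega M (s :: c) u v := by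
  rw [omega_append_singleton, omega, h, h']; ring

lemma omega_rotate_of_coord_eq_zero (M : CoxeterMatrix B) (c : List B) {s : B} {u v : B → ℝ}
    (h : u s = 0) (h' : v s = 0) : omega M (c ++ [s]) u v = omega M (s :: c) u v := by
  rw [omega_append_singleton, omega, h, h']; ring

lemma single_nonneg (s : B) : (0 : B → ℝ) ≤ Pi.single s 1 :=
  Pi.single_nonneg.mpr zero_le_one

lemma isNonInv_single (cs : CoxeterSystem M W) {s : B} {w : W}
    (h : cs.length w < cs.length (cs.simple s * w)) : IsNonInv cs w (Pi.single s 1) :=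
  ⟨isRoot_single cs s, single_nonneg s, (geom_inv_single_nonneg_iff cs w s).mpr h⟩

lemma fixesCoord_of_nbrSum_nonpos (cs : CoxeterSystem M W) {s : B} {c : List B}
    (hc : IsComplete (s :: c)) {w : W} (hs : cs.length w < cs.length (cs.simple s * w))
    (h : ∀ v, IsInv cs w v → nbrSum M c s v ≤ 0) :
    FixesCoord cs s w ∧ geom cs w (Pi.single s 1) = Pi.single s 1 :=
  fixesCoord_of_neighbours cs s w
    (fun r hr hrs => fixesCoord_of_isInv cs r w fun v hv =>
      nbrSum_eq_zero M hc.not_mem hv.nonneg (h v hv) r (hc.mem hr) hrs) hs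

lemma fixesCoord_of_nbrSum_geom_single (cs : CoxeterSystem M W) {s : B} {c : List B}
    (hc : IsComplete (s :: c)) {w : W} (hw : FixesCoord cs s w)
    (h : nbrSum M c s (geom cs w (Pi.single s 1)) ≤ 0) (r : B) (hr : r ≠ s)
    (hrs : cartan M s r ≠ 0) : FixesCoord cs r w :=
  fixesCoord_of_geom_single cs s w hw (fun q hq hqs =>
    nbrSum_eq_zero M hc.not_mem (geom_single_nonneg cs w s hw.length_lt_mul_simple) h q
      (hc.mem hq) hqs) r hr hrs

lemma nbrSum_eq_zero_of_fixesCoord (cs : CoxeterSystem M W) {s : B} {c : List B}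
    (hs : s ∉ c) {w : W} (h : ∀ r, r ≠ s → cartan M s r ≠ 0 → FixesCoord cs r w)
    {v : B → ℝ} (hv : IsInv cs w v) : nbrSum M c s v = 0 := by
  refine List.sum_eq_zero ?_
  simp only [List.mem_map]
  rintro x ⟨r, hr, rfl⟩
  by_cases hrs : cartan M s r = 0
  · simp [hrs]
  · rw [(h r (by rintro rfl; exact hs hr) hrs).coord_eq_zero hv, mul_zero]

/-- A functional that is nonnegative on the inversions of `w` is nonnegative on
`w e_s - e_s` when `w` lies in the parabolic subgroup omitting `s`. -/
lemma geom_single_sub_cone (cs : CoxeterSystem M W) {f : (B → ℝ) → ℝ}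
    (hadd : ∀ u v, f (u + v) = f u + f v) (hsmul : ∀ (a : ℝ) u, f (a • u) = a * f u)
    (s : B) (w : W) (hw : FixesCoord cs s w) (hf : ∀ v, IsInv cs w v → 0 ≤ f v) :
    f (Pi.single s 1) ≤ f (geom cs w (Pi.single s 1)) := by
  induction w using reduced_induction_right cs with
  | one => rw [geom_one_apply]
  | step w q hq ih =>
    have hw' : FixesCoord cs s w := fixesCoord_of_isInv cs s w fun v hv =>
      hw.coord_eq_zero (hv.mul_simple hq)
    have hqs : q ≠ s := by
      rintro rfl
      exact not_fixesCoord_mul_simple cs hw' hw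
    have h1 := ih hw' fun v hv => hf v (hv.mul_simple hq)
    have h2 := hf _ (isInv_mul_simple cs hq)
    have h3 : geom cs (w * cs.simple q) (Pi.single s 1) =
        geom cs w (Pi.single s 1) + (-cartan M q s) • geom cs w (Pi.single q 1) := by
      rw [geom_mul_apply, geom_simple_apply, coroot_single, map_sub, map_smul, neg_smul,
        sub_eq_add_neg]
    rw [h3, hadd, hsmul]
    have h4 := cartan_nonpos M hqs
    have h5 := mul_nonneg (neg_nonneg.mpr h4) h2
    linarith

lemma isSortable_simple (cs : CoxeterSystem M W) {c : List B} (hc : IsComplete c) (q : B) :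
    IsSortable cs c (cs.simple q) := by
  suffices h : ∀ w : W, w = cs.simple q → IsSortable cs c w from h _ rfl
  intro w
  refine rotation_induction cs (p := fun c w => w = cs.simple q → IsSortable cs c w)
    (fun c _ _ => isSortable_one cs c) ?_ ?_ hc w
  · rintro s c w hc hlt _ rfl
    rw [isSortable_cons_of_lt cs hc.not_mem hlt]
    rw [cs.length_simple, Nat.lt_one_iff, cs.length_eq_zero_iff] at hlt
    rw [hlt]
    exact isSortable_one cs _
  · rintro s c w hc hlt ih rfl
    rw [isSortable_cons_of_gt cs hc hlt]
    refine ⟨ih rfl, fixesCoord_simple cs ?_⟩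
    rintro rfl
    simp at hlt

/-- Sortability of `x` and of its upper cover `x s'` agree when the root separating them
pairs nonnegatively with all inversions of `x`. -/
lemma isSortable_mul_simple_iff (cs : CoxeterSystem M W) {c : List B} (hc : IsComplete c) {x : W}
    {s' : B} (hx : cs.length x < cs.length (x * cs.simple s'))
    (h : ∀ v, IsInv cs x v → 0 ≤ omega M c v (geom cs x (Pi.single s' 1))) :
    IsSortable cs c x ↔ IsSortable cs c (x * cs.simple s') := by
  refine rotation_induction cs (p := fun c x => ∀ s', cs.length x < cs.length (x * cs.simple s') →
    (∀ v, IsInv cs x v → 0 ≤ omega M c v (geom cs x (Pi.single s' 1))) →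
    (IsSortable cs c x ↔ IsSortable cs c (x * cs.simple s'))) ?_ ?_ ?_ hc x s' hx h
  · intro c hc s' _ _
    rw [one_mul]
    exact iff_of_true (isSortable_one cs c) (isSortable_simple cs hc s')
  · intro s c x hc hlt ih s' hx h
    have h1 : cs.length (cs.simple s * (x * cs.simple s')) < cs.length (x * cs.simple s') := by
      rw [← mul_assoc]
      rcases cs.length_mul_simple (cs.simple s * x) s' with h' | h' <;> omega
    rw [isSortable_cons_of_lt cs hc.not_mem hlt, isSortable_cons_of_lt cs hc.not_mem h1,
      ← mul_assoc]
    have h2 := cs.length_mul_simple (cs.simple s * x) s'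
    have h3 := cs.length_simple_mul (x * cs.simple s') s
    have h4 := cs.length_mul_simple x s'
    have h5 := cs.length_simple_mul x s
    rw [← mul_assoc] at h1 h3
    refine ih s' (by omega) fun v hv => ?_
    have h6 := hv.simple_mul (s := s) (hv.ne_smul (by simpa using hlt))
    rw [cs.simple_mul_simple_cancel_left] at h6
    have h7 := h _ h6
    rwa [← omega_geom_simple cs hc, geom_simple_geom_simple, ← geom_mul_apply] at h7
  · intro s c x hc hlt ih s' hx h
    rcases lt_or_gt_simple_mul cs (x * cs.simple s') s with h1 | h1
    · have he := geom_single_eq_single cs hlt h1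
      have hcomm := simple_mul_eq_mul_simple cs he
      rw [isSortable_cons_of_lt cs hc.not_mem h1, ← hcomm, cs.simple_mul_simple_cancel_left,
        isSortable_cons_of_gt cs hc hlt]
      refine and_iff_left (fixesCoord_of_nbrSum_nonpos cs hc hlt fun v hv => ?_).1
      have := h v hv
      rw [he, omega_single_right M hc.not_mem] at this
      linarith
    · rw [isSortable_cons_of_gt cs hc hlt, isSortable_cons_of_gt cs hc h1]
      by_cases hss : s' = s
      · subst hss
        refine iff_of_false (fun ⟨_, hF⟩ => ?_) (fun ⟨_, hF⟩ => ?_)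
        · have h2 := geom_single_sub_cone cs
            (f := fun v => omega M (s' :: c) v (geom cs x (Pi.single s' 1)))
            (fun _ _ => omega_add_left M _ _ _ _) (fun _ _ => omega_smul_left M _ _ _ _)
            s' x hF h
          simp only [omega_self, omega_single_left M hc.not_mem] at h2
          have h3 := (fixesCoord_of_neighbours cs s' x
            (fixesCoord_of_nbrSum_geom_single cs hc hF h2) hlt).2
          rw [← simple_mul_eq_mul_simple cs h3, cs.simple_mul_simple_cancel_left] at h1
          omega
        · have h2 := hF (Pi.single s' 1)
          rw [geom_simple_mul_single, Pi.neg_apply, Pi.single_eq_same] at h2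
          have h3 := geom_single_nonneg cs x s' hx s'
          simp only [Pi.zero_apply] at h3
          linarith
      · have hFiff : FixesCoord cs s (x * cs.simple s') ↔ FixesCoord cs s x := by
          refine ⟨fun hF => ?_, fun hF => hF.mul (fixesCoord_simple cs (Ne.symm hss))⟩
          have := hF.mul (fixesCoord_simple cs (Ne.symm hss))
          rwa [cs.simple_mul_simple_cancel_right] at this
        rw [hFiff]
        refine and_congr_left fun hF => ih s' hx fun v hv => ?_
        rw [omega_rotate_of_coord_eq_zero M c (hF.coord_eq_zero hv)]
        · exact h v hv
        · rw [hF, Pi.single_eq_of_ne (Ne.symm hss)]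

/-- Inversions of `w` pair nonnegatively with the positive roots that are not inversions. -/
def IsAligned (cs : CoxeterSystem M W) (c : List B) (w : W) : Prop :=
  ∀ u v, IsInv cs w u → IsNonInv cs w v → 0 ≤ omega M c u v

lemma nbrSum_nonpos_of_isAligned (cs : CoxeterSystem M W) {s : B} {c : List B} (hs : s ∉ c)
    {w : W} (hw : cs.length w < cs.length (cs.simple s * w)) (h : IsAligned cs (s :: c) w)
    {v : B → ℝ} (hv : IsInv cs w v) : nbrSum M c s v ≤ 0 := by
  have := h v _ hv (isNonInv_single cs hw)
  rw [omega_single_right M hs] at this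
  linarith

lemma IsAligned.isSortable {cs : CoxeterSystem M W} {c : List B} (hc : IsComplete c) {w : W}
    (h : IsAligned cs c w) : IsSortable cs c w := by
  refine rotation_induction cs (p := fun c w => IsAligned cs c w → IsSortable cs c w)
    (fun c _ _ => isSortable_one cs c) ?_ ?_ hc w h
  · intro s c w hc hlt ih h
    rw [isSortable_cons_of_lt cs hc.not_mem hlt]
    refine ih fun u v hu hv => ?_
    by_cases hne : ∀ a : ℝ, 0 ≤ a → v ≠ a • Pi.single s 1
    · have hu' := hu.simple_mul (s := s) (hu.ne_smul (by simpa using hlt))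
      have hv' := hv.simple_mul hne
      rw [cs.simple_mul_simple_cancel_left] at hu' hv'
      have := h _ _ hu' hv'
      rwa [← omega_geom_simple cs hc, geom_simple_geom_simple, geom_simple_geom_simple] at this
    · push Not at hne
      obtain ⟨a, ha, rfl⟩ := hne
      rw [omega_smul_right, omega_append_single_right M hc.not_mem]
      exact mul_nonneg ha (nbrSum_nonneg M hc.not_mem hu.nonneg)
  · intro s c w hc hlt ih h
    have hnon : ∀ v, IsInv cs w v → nbrSum M c s v ≤ 0 := fun v hv =>
      nbrSum_nonpos_of_isAligned cs hc.not_mem hlt h hv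
    have hF := (fixesCoord_of_nbrSum_nonpos cs hc hlt hnon).1
    rw [isSortable_cons_of_gt cs hc hlt]
    refine ⟨ih fun u v hu hv => ?_, hF⟩
    rw [omega_rotate_of_nbrSum_eq_zero M c (hF.coord_eq_zero hu)
      (le_antisymm (hnon u hu) (nbrSum_nonneg M hc.not_mem hu.nonneg))]
    exact h u v hu hv

lemma omega_nonpos_of_isSortable (cs : CoxeterSystem M W) {c : List B} (hc : IsComplete c) {w : W}
    (h : IsSortable cs c w) {u v : B → ℝ} {k : ℝ} (hk : 0 ≤ k) (hu : IsInv cs w u)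
    (hv : IsInv cs w v) (huv : IsNonInv cs w (u - k • v)) : omega M c u v ≤ 0 := by
  refine rotation_induction cs (p := fun c w => IsSortable cs c w → ∀ u v : B → ℝ,
    IsInv cs w u → IsInv cs w v → IsNonInv cs w (u - k • v) → omega M c u v ≤ 0)
    (fun c _ _ _ _ h => (not_isInv_one h).elim) ?_ ?_ hc w h u v hu hv huv
  · intro s c w hc hlt ih h u v hu hv huv
    rw [isSortable_cons_of_lt cs hc.not_mem hlt] at h
    by_cases hne : ∀ a : ℝ, 0 ≤ a → v ≠ a • Pi.single s 1
    · have hne' : ∀ a : ℝ, 0 ≤ a → u ≠ a • Pi.single s 1 := by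
        rintro a - rfl
        refine huv.ne_smul hlt _ (huv.nonneg s) ?_
        funext r
        by_cases hr : r = s
        · subst hr; simp
        · have h1 := huv.nonneg r
          have h2 := mul_nonneg hk (hv.nonneg r)
          simp only [Pi.zero_apply, Pi.sub_apply, Pi.smul_apply, smul_eq_mul,
            Pi.single_eq_of_ne hr, mul_zero] at h1 ⊢
          linarith
      rw [← omega_geom_simple cs hc]
      refine ih h _ _ (hu.simple_mul hne') (hv.simple_mul hne) ?_
      rw [← map_smul, ← map_sub]
      exact huv.simple_mul (huv.ne_smul hlt)
    · push Not at hne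
      obtain ⟨a, ha, rfl⟩ := hne
      rw [omega_smul_right, omega_single_right M hc.not_mem]
      have := mul_nonneg ha (nbrSum_nonneg M hc.not_mem hu.nonneg)
      linarith
  · intro s c w hc hlt ih h u v hu hv huv
    rw [isSortable_cons_of_gt cs hc hlt] at h
    rw [← omega_rotate_of_coord_eq_zero M c (h.2.coord_eq_zero hu) (h.2.coord_eq_zero hv)]
    exact ih h.1 u v hu hv huv

lemma isAligned_one (cs : CoxeterSystem M W) (c : List B) : IsAligned cs c 1 :=
  fun _ _ h _ => (not_isInv_one h).elim

lemma IsAligned.cons_of_lt {cs : CoxeterSystem M W} {s : B} {c : List B}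
    (hc : IsComplete (s :: c)) {w : W} (hlt : cs.length (cs.simple s * w) < cs.length w)
    (h : IsAligned cs (c ++ [s]) (cs.simple s * w)) : IsAligned cs (s :: c) w := by
  intro u v hu hv
  by_cases hne : ∀ a : ℝ, 0 ≤ a → u ≠ a • Pi.single s 1
  · rw [← omega_geom_simple cs hc]
    exact h _ _ (hu.simple_mul hne) (hv.simple_mul (hv.ne_smul hlt))
  · push Not at hne
    obtain ⟨a, ha, rfl⟩ := hne
    rw [omega_smul_left, omega_single_left M hc.not_mem]
    exact mul_nonneg ha (nbrSum_nonneg M hc.not_mem hv.nonneg)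

lemma IsAligned.cons_of_nbrSum_eq_zero {cs : CoxeterSystem M W} {s : B} {c : List B} {w : W}
    (h : IsAligned cs (c ++ [s]) w) (hF : FixesCoord cs s w)
    (h0 : ∀ v, IsInv cs w v → nbrSum M c s v = 0) : IsAligned cs (s :: c) w := by
  intro u v hu hv
  rw [← omega_rotate_of_nbrSum_eq_zero M c (hF.coord_eq_zero hu) (h0 u hu)]
  exact h u v hu hv

/-- Passing from `x` to `x s' = s x`, with `s` the last letter, does not affect sortability. -/
lemma isSortable_mul_simple_iff_of_geom_eq (cs : CoxeterSystem M W) {s s' : B} {c : List B}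
    (hc : IsComplete (s :: c)) {x : W} (hx : cs.length x < cs.length (x * cs.simple s'))
    (he : geom cs x (Pi.single s' 1) = Pi.single s 1) :
    IsSortable cs (c ++ [s]) x ↔ IsSortable cs (c ++ [s]) (x * cs.simple s') :=
  isSortable_mul_simple_iff cs hc.rotate hx fun v hv => by
    rw [he, omega_append_single_right M hc.not_mem]
    exact nbrSum_nonneg M hc.not_mem hv.nonneg

lemma isAligned_of_covers (cs : CoxeterSystem M W) {c : List B} (hc : IsComplete c) {w : W}
    (h : IsSortable cs c w) (h' : ∀ s, cs.length w < cs.length (w * cs.simple s) →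
      IsSortable cs c (w * cs.simple s)) : IsAligned cs c w := by
  refine rotation_induction cs (p := fun c w => IsSortable cs c w →
    (∀ s, cs.length w < cs.length (w * cs.simple s) → IsSortable cs c (w * cs.simple s)) →
    IsAligned cs c w) (fun c _ _ _ => isAligned_one cs c) ?_ ?_ hc w h h'
  · intro s c w hc hlt ih h h'
    rw [isSortable_cons_of_lt cs hc.not_mem hlt] at h
    refine (ih h fun q hq => ?_).cons_of_lt hc hlt
    have h1 := cs.length_mul_simple w q
    have h2 := cs.length_simple_mul w s
    have h3 := cs.length_mul_simple (cs.simple s * w) q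
    have h4 := cs.length_simple_mul (w * cs.simple q) s
    rw [← mul_assoc] at h4
    rcases Nat.lt_or_ge (cs.length w) (cs.length (w * cs.simple q)) with hwq | hwq
    · have h5 := h' q hwq
      rwa [isSortable_cons_of_lt cs hc.not_mem (by rw [← mul_assoc]; omega), ← mul_assoc] at h5
    · rw [← isSortable_mul_simple_iff_of_geom_eq cs hc hq]
      · exact h
      · apply geom_single_eq_single cs
        · simpa using hlt
        · rw [← mul_assoc, cs.simple_mul_simple_cancel_left]
          omega
  · intro s c w hc hlt ih h h'
    have hF := ((isSortable_cons_of_gt cs hc hlt).mp h).2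
    have hws := hF.length_lt_mul_simple
    have h1 := h' s hws
    have h2 : cs.length (cs.simple s * (w * cs.simple s)) < cs.length (w * cs.simple s) := by
      refine (lt_or_gt_simple_mul cs _ s).resolve_right fun h2 => ?_
      rw [isSortable_cons_of_gt cs hc h2] at h1
      exact not_fixesCoord_mul_simple cs hF h1.2
    have he := geom_single_eq_single cs hlt h2
    have h0 := fixesCoord_of_nbrSum_geom_single cs hc hF
      (by rw [he, nbrSum_single_self M hc.not_mem])
    rw [isSortable_cons_of_gt cs hc hlt] at h
    refine (ih h.1 fun q hq => ?_).cons_of_nbrSum_eq_zero hF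
      fun v hv => nbrSum_eq_zero_of_fixesCoord cs hc.not_mem h0 hv
    by_cases hqs : q = s
    · subst hqs
      exact (isSortable_mul_simple_iff_of_geom_eq cs hc hws he).mp h.1
    · rcases lt_or_gt_simple_mul cs (w * cs.simple q) s with h3 | h3
      · have h4 := (geom cs w).injective ((geom_single_eq_single cs hlt h3).trans he.symm)
        have h5 := congrFun h4 s
        rw [Pi.single_eq_same, Pi.single_eq_of_ne (Ne.symm hqs)] at h5
        exact absurd h5 zero_ne_one
      · exact ((isSortable_cons_of_gt cs hc h3).mp (h' q hq)).1

lemma geom_inv_longest_nonpos (cs : CoxeterSystem M W) {w₀ : W}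
    (hw₀ : ∀ u, cs.length u ≤ cs.length w₀) {v : B → ℝ} (hv : 0 ≤ v) :
    geom cs w₀⁻¹ v ≤ 0 := by
  have h : v = ∑ q, v q • (Pi.single q 1 : B → ℝ) := pi_eq_sum_univ' v
  rw [h, map_sum]
  refine Finset.sum_nonpos fun q _ => ?_
  rw [map_smul]
  refine smul_nonpos_of_nonneg_of_nonpos (hv q) ((geom_inv_single_nonpos_iff cs w₀ q).mpr ?_)
  have h1 := hw₀ (cs.simple q * w₀)
  rcases cs.length_simple_mul w₀ q with h' | h' <;> omega

lemma IsNonInv.mul_longest {cs : CoxeterSystem M W} {w₀ : W}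
    (hw₀ : ∀ u, cs.length u ≤ cs.length w₀) {w : W} {v : B → ℝ} (hv : IsNonInv cs w v) :
    IsInv cs (w * w₀) v :=
  ⟨hv.isRoot, hv.nonneg, by
    rw [mul_inv_rev, geom_mul_apply]
    exact geom_inv_longest_nonpos cs hw₀ hv.nonneg'⟩

lemma IsInv.mul_longest {cs : CoxeterSystem M W} {w₀ : W}
    (hw₀ : ∀ u, cs.length u ≤ cs.length w₀) {w : W} {v : B → ℝ} (hv : IsInv cs w v) :
    IsNonInv cs (w * w₀) v :=
  ⟨hv.isRoot, hv.nonneg, by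
    rw [mul_inv_rev, geom_mul_apply, ← neg_nonpos, ← map_neg]
    exact geom_inv_longest_nonpos cs hw₀ (neg_nonneg.mpr hv.nonpos)⟩

lemma IsInv.of_mul_longest {cs : CoxeterSystem M W} {w₀ : W}
    (hw₀ : ∀ u, cs.length u ≤ cs.length w₀) {w : W} {v : B → ℝ} (hv : IsInv cs (w * w₀) v) :
    IsNonInv cs w v := by
  rcases (hv.isRoot.geom w⁻¹).nonneg_or_nonpos with h | h
  · exact ⟨hv.isRoot, hv.nonneg, h⟩
  · exact (hv.not_isNonInv (IsInv.mul_longest hw₀ ⟨hv.isRoot, hv.nonneg, h⟩)).elim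

lemma IsNonInv.of_mul_longest {cs : CoxeterSystem M W} {w₀ : W}
    (hw₀ : ∀ u, cs.length u ≤ cs.length w₀) {w : W} {v : B → ℝ} (hv : IsNonInv cs (w * w₀) v) :
    IsInv cs w v := by
  rcases (hv.isRoot.geom w⁻¹).nonneg_or_nonpos with h | h
  · exact ((IsNonInv.mul_longest hw₀ ⟨hv.isRoot, hv.nonneg, h⟩).not_isNonInv hv).elim
  · exact ⟨hv.isRoot, hv.nonneg, h⟩

lemma length_simple_mul_mul_longest (cs : CoxeterSystem M W) {w₀ : W}
    (hw₀ : ∀ u, cs.length u ≤ cs.length w₀) {w : W} {s : B}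
    (h : cs.length w < cs.length (cs.simple s * w)) :
    cs.length (cs.simple s * (w * w₀)) < cs.length (w * w₀) :=
  (geom_inv_single_nonpos_iff cs (w * w₀) s).mp
    ((isNonInv_single cs h).mul_longest hw₀).nonpos

lemma length_mul_longest (cs : CoxeterSystem M W) {w₀ : W}
    (hw₀ : ∀ u, cs.length u ≤ cs.length w₀) (w : W) :
    cs.length (w * w₀) + cs.length w = cs.length w₀ := by
  induction w using reduced_induction_left cs with
  | one => simp
  | step w s hs ih =>
    have h1 := length_simple_mul_mul_longest cs hw₀ hs
    have h2 := cs.length_simple_mul w s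
    have h3 := cs.length_simple_mul (w * w₀) s
    rw [mul_assoc]
    omega

lemma exists_simple_eq_conj_longest (cs : CoxeterSystem M W) {w₀ : W}
    (hw₀ : ∀ u, cs.length u ≤ cs.length w₀) (s : B) :
    ∃ s', cs.simple s * w₀ = w₀ * cs.simple s' := by
  have hinv : w₀⁻¹ = w₀ := by
    have h := length_mul_longest cs hw₀ w₀
    rw [Nat.add_eq_right, cs.length_eq_zero_iff] at h
    exact inv_eq_of_mul_eq_one_left h
  have h1 := length_mul_longest cs hw₀ (cs.simple s)
  have h2 := length_mul_longest cs hw₀ (cs.simple s * w₀)⁻¹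
  rw [cs.length_inv, ← cs.length_inv ((cs.simple s * w₀)⁻¹ * w₀), mul_inv_rev, inv_inv] at h2
  rw [cs.length_simple] at h1
  obtain ⟨s', hs'⟩ := cs.length_eq_one_iff.mp
    (show cs.length (w₀⁻¹ * (cs.simple s * w₀)) = 1 by omega)
  exact ⟨s', by rw [← hs', mul_inv_cancel_left]⟩

lemma IsComplete.reverse {c : List B} (hc : IsComplete c) : IsComplete c.reverse :=
  ⟨List.nodup_reverse.mpr hc.1, fun b => List.mem_reverse.mpr (hc.2 b)⟩

lemma IsComplete.cons_reverse {s : B} {c : List B} (hc : IsComplete (s :: c)) :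
    IsComplete (s :: c.reverse) := by
  simpa using hc.rotate.reverse

lemma isAligned_of_isCSingleton (cs : CoxeterSystem M W) {c : List B} (hc : IsComplete c)
    {w₀ w : W} (hw₀ : ∀ u, cs.length u ≤ cs.length w₀) (h : IsCSingleton cs c w₀ w) :
    IsAligned cs c w := by
  refine rotation_induction cs (p := fun c w => IsCSingleton cs c w₀ w → IsAligned cs c w)
    (fun c _ _ => isAligned_one cs c) ?_ ?_ hc w h
  · rintro s c w hc hlt ih ⟨h1, h2⟩
    rw [isSortable_cons_of_lt cs hc.not_mem hlt] at h1
    rw [List.reverse_cons] at h2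
    refine (ih ⟨h1, ?_⟩).cons_of_lt hc hlt
    have h3 := length_simple_mul_mul_longest cs hw₀ (w := cs.simple s * w) (s := s)
      (by simpa using hlt)
    rw [List.reverse_append, List.reverse_singleton, List.singleton_append,
      isSortable_cons_of_lt cs hc.cons_reverse.not_mem h3, mul_assoc,
      cs.simple_mul_simple_cancel_left]
    exact h2
  · rintro s c w hc hlt ih ⟨h1, h2⟩
    rw [isSortable_cons_of_gt cs hc hlt] at h1
    rw [List.reverse_cons] at h2
    obtain ⟨h1, hF⟩ := h1
    have hrc := hc.cons_reverse
    have hnon : ∀ v, IsInv cs w v → nbrSum M c s v ≤ 0 := by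
      intro v hv
      by_contra! hpos
      have hvs := hF.coord_eq_zero hv
      have hsv : geom cs (cs.simple s) v = v + nbrSum M c s v • Pi.single s 1 := by
        rw [geom_simple_apply, coroot_eq_nbrSum hc, hvs]
        module
      have hroot := hv.isRoot.geom (cs.simple s)
      have hcoord : geom cs (cs.simple s) v s = nbrSum M c s v := by
        rw [hsv]; simp [hvs]
      have hnoninv : IsNonInv cs w (geom cs (cs.simple s) v) := by
        refine ⟨hroot, hroot.nonneg_of_pos (r := s) (by rwa [hcoord]),
          (hroot.geom w⁻¹).nonneg_of_pos (r := s) ?_⟩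
        rw [hF.inv, hcoord]
        exact hpos
      have h3 := omega_nonpos_of_isSortable cs hrc.rotate h2 hpos.le
        (hnoninv.mul_longest hw₀) ((isNonInv_single cs hlt).mul_longest hw₀)
        (by rw [hsv, add_sub_cancel_right]; exact hv.mul_longest hw₀)
      rw [omega_append_single_right M hrc.not_mem, nbrSum_reverse,
        nbrSum_geom_simple cs hc.not_mem] at h3
      linarith
    have he := (fixesCoord_of_nbrSum_nonpos cs hc hlt hnon).2
    have hcomm := simple_mul_eq_mul_simple cs he
    refine (ih ⟨h1, ?_⟩).cons_of_nbrSum_eq_zero hF fun v hv =>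
      le_antisymm (hnon v hv) (nbrSum_nonneg M hc.not_mem hv.nonneg)
    have hlt' := length_simple_mul_mul_longest cs hw₀ hlt
    obtain ⟨s', hs'⟩ := exists_simple_eq_conj_longest cs hw₀ s
    have hx : cs.simple s * (w * w₀) * cs.simple s' = w * w₀ := by
      rw [mul_assoc, mul_assoc, ← hs', ← mul_assoc w, ← hcomm, mul_assoc,
        cs.simple_mul_simple_cancel_left]
    rw [List.reverse_append, List.reverse_singleton, List.singleton_append,
      isSortable_cons_of_lt cs hrc.not_mem hlt',
      isSortable_mul_simple_iff_of_geom_eq cs hrc (s' := s') (by rwa [hx]), hx]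
    · exact h2
    · apply geom_single_eq_single cs
      · rwa [cs.simple_mul_simple_cancel_left]
      · rwa [hx]

lemma IsAligned.reverse_mul_longest {cs : CoxeterSystem M W} {c : List B} {w₀ w : W}
    (hw₀ : ∀ u, cs.length u ≤ cs.length w₀) (h : IsAligned cs c w) :
    IsAligned cs c.reverse (w * w₀) := by
  intro u v hu hv
  rw [omega_reverse, omega_swap, neg_neg]
  exact h v u (hv.of_mul_longest hw₀) (hu.of_mul_longest hw₀)

lemma isSortable_and_covers_iff (cs : CoxeterSystem M W) {c : List B} (hc : IsComplete c)
    {w₀ : W} (hw₀ : ∀ u, cs.length u ≤ cs.length w₀) (w : W) :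
    (IsSortable cs c w ∧ ∀ s, cs.length w < cs.length (w * cs.simple s) →
      IsSortable cs c (w * cs.simple s)) ↔
    (IsSortable cs c w ∧ IsSortable cs c.reverse (w * w₀)) := by
  constructor
  · rintro ⟨h, h'⟩
    exact ⟨h, ((isAligned_of_covers cs hc h h').reverse_mul_longest hw₀).isSortable hc.reverse⟩
  · intro h
    have ha := isAligned_of_isCSingleton cs hc hw₀ h
    refine ⟨h.1, fun s hs => (isSortable_mul_simple_iff cs hc hs fun v hv => ?_).mp h.1⟩
    exact ha _ _ hv (isNonInv_geom_single cs hs)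

end

end Geometric

/-- Proposition on `c`-singletons, (ii) ⇔ (iii).
Let `(W,S)` be a finite Coxeter system with longest element `w₀` and `c` a Coxeter element
(given by a reduced word `c : List B` listing each simple reflection exactly once).
For `w ∈ W` the following are equivalent:
(a) `w` is `c`-sortable and `w s` is `c`-sortable for every `s ∈ S` with `ℓ(ws) > ℓ(w)`;
(b) `w` is `c`-sortable and `w w₀` is `c⁻¹`-sortable. -/
theorem statement0 [Finite W] (cs : CoxeterSystem M W)
    (c : List B) (hnd : c.Nodup) (hall : ∀ b : B, b ∈ c)
    (w₀ : W) (hw₀ : ∀ u : W, cs.length u ≤ cs.length w₀)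
    (w : W) :
    (IsSortable cs c w ∧
      ∀ s : B, cs.length w < cs.length (w * cs.simple s) →
        IsSortable cs c (w * cs.simple s))
    ↔ (IsSortable cs c w ∧ IsSortable cs c.reverse (w * w₀)) := by
  classical
  let _ : Fintype B := ⟨c.toFinset, fun b => List.mem_toFinset.mpr (hall b)⟩
  exact isSortable_and_covers_iff cs ⟨hnd, hall⟩ hw₀ w

end CambrianPaper

end
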